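/- arXiv:2209.10539 — 2 statements merged into one kernel-verified Lean document; each statement's English description precedes it below -/
import Mathlib

section
/- For every matrix hypergraph G = (S, A, v) with A ∈ ℝ^{m×n}, rank r = max_{S∈S} |S|, and every ε ∈ (0,1), there exists a vector v' ∈ ℝ_{≥0}^k supported on at most C · n ε^{-2} log m · log r groups, for an absolute constant C, such that the matrix hypergraph H = (S, A, v') satisfies (1+ε)^{-1} f_H(x) ≤ f_G(x) ≤ (1+ε) f_H(x) for all x ∈ ℝ^n. -/
open Finset Matrix Real MeasureTheory
open scoped Classical

/-- `gval A T x = max_{j ∈ T} |⟨a_j, x⟩|`, where `a_j` are the rows of `A`. -/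
noncomputable def gval {m n : ℕ} (A : Matrix (Fin m) (Fin n) ℝ) (T : Finset (Fin m))
    (x : Fin n → ℝ) : ℝ :=
  if h : T.Nonempty then T.sup' h (fun j => |A j ⬝ᵥ x|) else 0

/-- The energy `f_G(x) = Σ_i v_i · max_{j ∈ S_i} ⟨a_j, x⟩²` of a matrix hypergraph
with group weights `v`. -/
noncomputable def wenergy {m n k : ℕ} (A : Matrix (Fin m) (Fin n) ℝ)
    (S : Fin k → Finset (Fin m)) (v : Fin k → ℝ) (x : Fin n → ℝ) : ℝ :=
  ∑ i, v i * (gval A (S i) x) ^ 2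

theorem sum_exp_signs_le {ι : Type*} [Fintype ι] (a : ι → ℝ) :
    ∑ σ : ι → Bool, exp (∑ i, (if σ i then (1 : ℝ) else -1) * a i) ≤
      2 ^ Fintype.card ι * exp (∑ i, a i ^ 2 / 2) := by
  have h1 : ∑ σ : ι → Bool, exp (∑ i, (if σ i then (1 : ℝ) else -1) * a i) =
      ∏ i, ∑ b : Bool, exp ((if b then (1 : ℝ) else -1) * a i) := by
    rw [Finset.prod_univ_sum]
    simp only [Real.exp_sum, Fintype.piFinset_univ]
  rw [h1, Real.exp_sum, ← Finset.card_univ, ← Finset.prod_const, ← Finset.prod_mul_distrib]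
  refine Finset.prod_le_prod (fun i _ => Finset.sum_nonneg fun b _ => (exp_pos _).le) ?_
  intro i _
  have := Real.cosh_le_exp_half_sq (a i)
  rw [Real.cosh_eq] at this
  simp
  linarith

theorem exists_signs {ι κ : Type*} [Fintype ι] (K : Finset κ) (c : κ → ι → ℝ) (s : κ → ℝ)
    (hs : ∀ l ∈ K, 0 < s l) (h : ∑ l ∈ K, 2 * exp (-(s l) ^ 2 / 2) ≤ 1) :
    ∃ σ : ι → ℝ, (∀ i, σ i = 1 ∨ σ i = -1) ∧
      ∀ l ∈ K, |∑ i, σ i * c l i| ≤ s l * √(∑ i, c l i ^ 2) := by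
  set d : κ → ℝ := fun l => √(∑ i, c l i ^ 2) with hd
  set Φ : (ι → Bool) → ℝ := fun σ => ∑ l ∈ K.filter (fun l => d l ≠ 0),
    (exp (∑ i, (if σ i then (1 : ℝ) else -1) * (s l / d l * c l i)) * exp (-s l ^ 2) +
      exp (∑ i, (if σ i then (1 : ℝ) else -1) * (-(s l / d l) * c l i)) * exp (-s l ^ 2)) with hΦ
  have hsum : ∑ σ, Φ σ ≤ ∑ σ : ι → Bool, (1 : ℝ) := by
    simp only [hΦ]
    rw [Finset.sum_comm]
    have hcard : ∑ σ : ι → Bool, (1 : ℝ) = 2 ^ Fintype.card ι := by simp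
    rw [hcard]
    calc _ ≤ ∑ l ∈ K.filter (fun l => d l ≠ 0),
            2 ^ Fintype.card ι * (2 * exp (-(s l) ^ 2 / 2)) := by
          refine Finset.sum_le_sum fun l hl => ?_
          have hdl : d l ≠ 0 := (Finset.mem_filter.1 hl).2
          rw [Finset.sum_add_distrib, ← Finset.sum_mul, ← Finset.sum_mul]
          have key : ∑ i, c l i ^ 2 = d l ^ 2 :=
            (Real.sq_sqrt (Finset.sum_nonneg fun i _ => sq_nonneg _)).symm
          have e1 : ∑ i, (s l / d l * c l i) ^ 2 / 2 = s l ^ 2 / 2 := by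
            rw [← Finset.sum_div]
            simp only [mul_pow]
            rw [← Finset.mul_sum, key]
            field_simp
          have e2 : ∑ i, (-(s l / d l) * c l i) ^ 2 / 2 = s l ^ 2 / 2 := by
            rw [← e1]; simp only [neg_mul, neg_sq]
          have b1 := sum_exp_signs_le (fun i => s l / d l * c l i)
          have b2 := sum_exp_signs_le (fun i => -(s l / d l) * c l i)
          rw [e1] at b1
          rw [e2] at b2
          have e3 : exp (-(s l) ^ 2 / 2) = exp (s l ^ 2 / 2) * exp (-s l ^ 2) := by
            rw [← Real.exp_add]; congr 1; ring
          rw [e3]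
          have := mul_le_mul_of_nonneg_right (add_le_add b1 b2) (exp_pos (-s l ^ 2)).le
          linarith
      _ ≤ ∑ l ∈ K, 2 ^ Fintype.card ι * (2 * exp (-(s l) ^ 2 / 2)) :=
          Finset.sum_le_sum_of_subset_of_nonneg (Finset.filter_subset _ _)
            (fun _ _ _ => by positivity)
      _ ≤ _ := by
          rw [← Finset.mul_sum]
          have : (0 : ℝ) < 2 ^ Fintype.card ι := by positivity
          nlinarith
  obtain ⟨σ, -, hσ⟩ := Finset.exists_le_of_sum_le Finset.univ_nonempty hsum
  refine ⟨fun i => if σ i then 1 else -1, fun i => by by_cases hi : σ i <;> simp [hi], ?_⟩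
  intro l hl
  change _ ≤ s l * d l
  by_cases hdl : d l = 0
  · have h0 : ∀ i, c l i = 0 := by
      have h1 : ∑ i, c l i ^ 2 = 0 :=
        (Real.sqrt_eq_zero (Finset.sum_nonneg fun i _ => sq_nonneg _)).1 hdl
      intro i
      have := (Finset.sum_eq_zero_iff_of_nonneg (fun i _ => sq_nonneg (c l i))).1 h1 i
        (Finset.mem_univ i)
      exact pow_eq_zero_iff (two_ne_zero) |>.1 this
    simp [h0, hdl]
  · have hdpos : 0 < d l := lt_of_le_of_ne (Real.sqrt_nonneg _) (Ne.symm hdl)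
    have hsl := hs l hl
    set X := ∑ i, (if σ i then (1 : ℝ) else -1) * c l i with hX
    have hterm : exp (s l / d l * X) * exp (-s l ^ 2) +
        exp (-(s l / d l) * X) * exp (-s l ^ 2) ≤ 1 := by
      refine le_trans ?_ hσ
      have := Finset.single_le_sum (f := fun l =>
        (exp (∑ i, (if σ i then (1 : ℝ) else -1) * (s l / d l * c l i)) * exp (-s l ^ 2) +
      exp (∑ i, (if σ i then (1 : ℝ) else -1) * (-(s l / d l) * c l i)) * exp (-s l ^ 2)))
        (s := K.filter (fun l => d l ≠ 0)) (fun _ _ => by positivity)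
        (Finset.mem_filter.2 ⟨hl, hdl⟩)
      refine le_trans (le_of_eq ?_) this
      simp only [hX, Finset.mul_sum, mul_left_comm]
    rw [← Real.exp_add, ← Real.exp_add] at hterm
    have p1 : s l / d l * X + -s l ^ 2 ≤ 0 := by
      rw [← Real.exp_le_one_iff]; linarith [exp_pos (-(s l / d l) * X + -s l ^ 2)]
    have p2 : -(s l / d l) * X + -s l ^ 2 ≤ 0 := by
      rw [← Real.exp_le_one_iff]; linarith [exp_pos ((s l / d l) * X + -s l ^ 2)]
    have e : s l / d l * X = s l * (X / d l) := by ring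
    have p1' : X / d l ≤ s l := by
      by_contra hc; push Not at hc
      nlinarith
    have p2' : -s l ≤ X / d l := by
      by_contra hc; push Not at hc
      nlinarith
    rw [div_le_iff₀ hdpos] at p1'
    rw [le_div_iff₀ hdpos] at p2'
    rw [abs_le]; constructor <;> linarith

section Gaussian
variable {E : Type*} [NormedAddCommGroup E]

/-- The unnormalised standard Gaussian weight. -/
noncomputable def gweight (z : E) : ℝ := exp (-‖z‖ ^ 2 / 2)

theorem gweight_pos (z : E) : 0 < gweight z := exp_pos _

theorem gweight_neg (z : E) : gweight (-z) = gweight z := by simp [gweight]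

theorem gweight_continuous : Continuous (gweight : E → ℝ) := by
  unfold gweight; fun_prop

variable [InnerProductSpace ℝ E]

theorem gweight_sub (z c : E) :
    gweight (z - c) = exp (-‖c‖ ^ 2 / 2) * (exp (inner ℝ c z) * gweight z) := by
  unfold gweight
  rw [← Real.exp_add, ← Real.exp_add, norm_sub_sq_real, real_inner_comm]
  congr 1; ring

variable [FiniteDimensional ℝ E] [MeasurableSpace E] [BorelSpace E]

theorem integral_gweight_pos : 0 < ∫ z : E, gweight z := by
  have h := GaussianFourier.integral_rexp_neg_mul_sq_norm (V := E) (b := 1 / 2) (by norm_num)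
  have : (fun z : E => gweight z) = fun z => rexp (-(1 / 2) * ‖z‖ ^ 2) := by
    ext z; unfold gweight; congr 1; ring
  rw [this, h]
  positivity

theorem integrable_gweight : Integrable (gweight : E → ℝ) := by
  by_contra h
  exact absurd (integral_undef h) (integral_gweight_pos (E := E)).ne'

theorem integrable_exp_inner_mul_gweight (c : E) :
    Integrable fun z : E => exp (inner ℝ c z) * gweight z := by
  have h := (integrable_gweight (E := E)).comp_sub_right c
  simp only [gweight_sub] at h
  have h2 := h.const_mul (exp (‖c‖ ^ 2 / 2))
  refine h2.congr (Filter.Eventually.of_forall fun z => ?_)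
  simp only
  rw [← mul_assoc, ← Real.exp_add]
  ring_nf; simp

theorem integral_exp_inner_mul_gweight (c : E) :
    ∫ z : E, exp (inner ℝ c z) * gweight z = exp (‖c‖ ^ 2 / 2) * ∫ z : E, gweight z := by
  have h := integral_sub_right_eq_self (μ := (volume : Measure E)) (fun z : E => gweight z) c
  simp only [gweight_sub] at h
  rw [integral_const_mul] at h
  rw [← h, ← mul_assoc, ← Real.exp_add]
  ring_nf; simp

theorem setIntegral_gweight_sub_ge {K : Set E} (hK : MeasurableSet K)
    (hsymm : ∀ z, -z ∈ K ↔ z ∈ K) (p : E) :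
    exp (-‖p‖ ^ 2 / 2) * ∫ z in K, gweight z ≤ ∫ z in K, gweight (z - p) := by
  simp only [gweight_sub]
  rw [integral_const_mul]
  refine mul_le_mul_of_nonneg_left ?_ (exp_pos _).le
  have h1 : ∫ z in K, exp (inner ℝ p z) * gweight z =
      ∫ z in K, exp (-inner ℝ p z) * gweight z := by
    rw [← integral_indicator hK, ← integral_indicator hK, ← integral_neg_eq_self]
    congr 1; ext z
    by_cases hz : z ∈ K
    · rw [Set.indicator_of_mem hz, Set.indicator_of_mem ((hsymm z).2 hz), inner_neg_right,
        gweight_neg]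
    · rw [Set.indicator_of_notMem hz, Set.indicator_of_notMem (fun h => hz ((hsymm z).1 h))]
  have i1 := (integrable_exp_inner_mul_gweight p).integrableOn (s := K)
  have i2 : IntegrableOn (fun z : E => exp (-inner ℝ p z) * gweight z) K := by
    have := (integrable_exp_inner_mul_gweight (-p)).integrableOn (s := K)
    simpa only [inner_neg_left] using this
  have h2 : ∫ z in K, 2 * gweight z ≤
      ∫ z in K, (exp (inner ℝ p z) * gweight z + exp (-inner ℝ p z) * gweight z) := by
    refine integral_mono ((integrable_gweight.const_mul 2).integrableOn) (i1.add i2) fun z => ?_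
    have hc := Real.one_le_cosh (inner ℝ p z)
    rw [Real.cosh_eq] at hc
    have := gweight_pos z
    simp only
    nlinarith
  rw [integral_add i1 i2, integral_const_mul, ← h1] at h2
  linarith

theorem card_le_of_disjoint_translates {K : Set E} (hK : MeasurableSet K)
    (hsymm : ∀ z, -z ∈ K ↔ z ∈ K) (hhalf : (∫ z : E, gweight z) / 2 ≤ ∫ z in K, gweight z)
    (P : Finset E) {R : ℝ} (hR : ∀ p ∈ P, ‖p‖ ≤ R)
    (hdisj : ∀ p ∈ P, ∀ q ∈ P, p ≠ q → ∀ z, z - p ∈ K → z - q ∉ K) :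
    (P.card : ℝ) ≤ 2 * exp (R ^ 2 / 2) := by
  set I := ∫ z : E, gweight z with hI
  have hIpos : 0 < I := integral_gweight_pos
  have key : ∀ p ∈ P, exp (-R ^ 2 / 2) * (I / 2) ≤ ∫ z in (fun z => z - p) ⁻¹' K, gweight z := by
    intro p hp
    have h1 : ∫ z in (fun z => z - p) ⁻¹' K, gweight z = ∫ z in K, gweight (z - (-p)) := by
      rw [← integral_indicator hK, ← integral_indicator (hK.preimage (by fun_prop)),
        ← integral_sub_right_eq_self (K.indicator fun z => gweight (z - -p)) p]
      congr 1; ext z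
      by_cases hz : z - p ∈ K
      · rw [Set.indicator_of_mem hz, Set.indicator_of_mem (show z ∈ (fun z => z - p) ⁻¹' K from hz)]
        simp
      · rw [Set.indicator_of_notMem hz,
          Set.indicator_of_notMem (show z ∉ (fun z => z - p) ⁻¹' K from hz)]
    rw [h1]
    refine le_trans ?_ (setIntegral_gweight_sub_ge hK hsymm (-p))
    rw [norm_neg]
    have := hR p hp
    have h0 := norm_nonneg p
    refine mul_le_mul (Real.exp_le_exp.2 (by nlinarith)) hhalf (by positivity) (exp_pos _).le
  have hsum : ∑ p ∈ P, ∫ z in (fun z => z - p) ⁻¹' K, gweight z ≤ I := by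
    rw [← integral_biUnion_finset]
    · exact setIntegral_le_integral integrable_gweight
        (Filter.Eventually.of_forall fun z => (gweight_pos z).le)
    · exact fun p _ => hK.preimage (by fun_prop)
    · intro p hp q hq hpq
      exact Set.disjoint_left.2 fun z hz hz' => hdisj p hp q hq hpq z hz hz'
    · exact fun p _ => integrable_gweight.integrableOn
  have h3 := (Finset.sum_le_sum key).trans hsum
  rw [Finset.sum_const, nsmul_eq_mul] at h3
  have e : exp (R ^ 2 / 2) * exp (-R ^ 2 / 2) = 1 := by
    rw [← Real.exp_add]; ring_nf; simp
  have hp := exp_pos (R ^ 2 / 2)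
  have h4 : (P.card : ℝ) * exp (-R ^ 2 / 2) ≤ 2 := by
    by_contra hc; push Not at hc
    nlinarith
  calc (P.card : ℝ) = exp (R ^ 2 / 2) * (P.card * exp (-R ^ 2 / 2)) := by
        rw [mul_left_comm, e, mul_one]
    _ ≤ exp (R ^ 2 / 2) * 2 := by gcongr
    _ = _ := by ring

theorem exists_separated_net {α : Type*} (d : α → α → ℝ) (hd : ∀ x, d x x = 0)
    (hsymm : ∀ x y, d x y = d y x) {s : ℝ} (hs : 0 ≤ s) (Y : Finset α) :
    ∃ P ⊆ Y, (∀ p ∈ P, ∀ q ∈ P, p ≠ q → s < d p q) ∧ ∀ y ∈ Y, ∃ p ∈ P, d y p ≤ s := by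
  induction Y using Finset.induction_on with
  | empty => exact ⟨∅, by simp⟩
  | insert a Y ha ih =>
    obtain ⟨P, hPY, hsep, hcov⟩ := ih
    by_cases h : ∃ p ∈ P, d a p ≤ s
    · refine ⟨P, hPY.trans (Finset.subset_insert _ _), hsep, ?_⟩
      intro y hy
      rcases Finset.mem_insert.1 hy with rfl | hy
      · exact h
      · exact hcov y hy
    · push Not at h
      refine ⟨insert a P, Finset.insert_subset_insert _ hPY, ?_, ?_⟩
      · intro p hp q hq hpq
        rcases Finset.mem_insert.1 hp with hp | hp <;> rcases Finset.mem_insert.1 hq with hq | hq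
        · exact absurd (hp.trans hq.symm) hpq
        · rw [hp]; exact h q hq
        · rw [hq, hsymm]; exact h p hp
        · exact hsep p hp q hq hpq
      · intro y hy
        rcases Finset.mem_insert.1 hy with rfl | hy
        · exact ⟨y, Finset.mem_insert_self _ _, by rw [hd]; exact hs⟩
        · obtain ⟨p, hp, h⟩ := hcov y hy
          exact ⟨p, Finset.mem_insert_of_mem hp, h⟩

theorem exists_coloring (N : Seminorm ℝ E) (hN : Continuous N)
    (hhalf : (∫ z : E, gweight z) / 2 ≤ ∫ z in {z : E | N z ≤ 1}, gweight z)
    (Y : Finset E) (c : E) {R s : ℝ} (hs : 0 < s) (hY : ∀ y ∈ Y, ‖y - c‖ ≤ R) :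
    ∃ col : E → E, ((Y.image col).card : ℝ) ≤ 2 * exp ((R / s) ^ 2 / 2) ∧
      ∀ y ∈ Y, ∀ y' ∈ Y, col y = col y' → N (y - y') ≤ 4 * s := by
  obtain ⟨P, hPY, hsep, hcov⟩ := exists_separated_net (fun x y => N (x - y)) (by simp)
    (fun x y => by rw [map_sub_rev]) (s := 2 * s) (by positivity) Y
  choose! col hcolP hcol using hcov
  refine ⟨col, ?_, ?_⟩
  · have hsub : Y.image col ⊆ P := by
      intro p hp
      obtain ⟨y, hy, rfl⟩ := Finset.mem_image.1 hp
      exact hcolP y hy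
    refine le_trans (Nat.cast_le.2 (Finset.card_le_card hsub)) ?_
    have hinj : Function.Injective fun p : E => s⁻¹ • (p - c) := by
      intro p q h
      have := smul_right_injective E (inv_ne_zero hs.ne') h
      exact sub_left_injective this
    rw [← Finset.card_image_of_injective P hinj]
    refine card_le_of_disjoint_translates (K := {z : E | N z ≤ 1})
      (measurableSet_le hN.measurable measurable_const) (fun z => by simp) hhalf _ ?_ ?_
    · intro p hp
      obtain ⟨y, hy, rfl⟩ := Finset.mem_image.1 hp
      rw [norm_smul, norm_inv, Real.norm_of_nonneg hs.le, inv_mul_eq_div]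
      gcongr
      exact hY y (hPY hy)
    · intro p hp q hq hpq z hz hz'
      obtain ⟨a, ha, rfl⟩ := Finset.mem_image.1 hp
      obtain ⟨b, hb, rfl⟩ := Finset.mem_image.1 hq
      have hab : a ≠ b := fun h => hpq (by rw [h])
      have h1 := hsep a ha b hb hab
      simp only [Set.mem_ofPred_eq] at hz hz' h1
      have h2 : s⁻¹ • (a - b) = (z - s⁻¹ • (b - c)) - (z - s⁻¹ • (a - c)) := by module
      have h3 : N (s⁻¹ • (a - b)) ≤ 2 := by
        rw [h2]; exact (map_sub_le_add N _ _).trans (by linarith)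
      rw [map_smul_eq_mul, norm_inv, Real.norm_of_nonneg hs.le, inv_mul_le_iff₀ hs] at h3
      linarith
  · intro y hy y' hy' h
    have h1 := hcol y hy
    have h2 := hcol y' hy'
    have h3 : y - y' = (y - col y) - (y' - col y') := by rw [h]; abel
    rw [h3]
    exact (map_sub_le_add N _ _).trans (by linarith)

end Gaussian

theorem Seminorm.continuous_of_finrank {E : Type*} [NormedAddCommGroup E] [NormedSpace ℝ E]
    [FiniteDimensional ℝ E] (p : Seminorm ℝ E) : Continuous p :=
  (ConvexOn.locallyLipschitz p.convexOn).continuous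

/-- The `ℓ²` norm of a finite real family. -/
noncomputable def l2 {ι : Type*} [Fintype ι] (f : ι → ℝ) : ℝ := √(∑ i, f i ^ 2)

section l2
variable {ι : Type*} [Fintype ι]

theorem l2_eq_norm (f : ι → ℝ) : l2 f = ‖WithLp.toLp 2 f‖ := by
  rw [EuclideanSpace.norm_eq]; simp [l2]

theorem l2_nonneg (f : ι → ℝ) : 0 ≤ l2 f := Real.sqrt_nonneg _

theorem l2_sq (f : ι → ℝ) : l2 f ^ 2 = ∑ i, f i ^ 2 :=
  Real.sq_sqrt (Finset.sum_nonneg fun _ _ => sq_nonneg _)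

theorem l2_add_le (f g : ι → ℝ) : l2 (fun i => f i + g i) ≤ l2 f + l2 g := by
  rw [l2_eq_norm, l2_eq_norm, l2_eq_norm]
  exact norm_add_le (WithLp.toLp 2 f) (WithLp.toLp 2 g)

theorem l2_const_mul (c : ℝ) (f : ι → ℝ) : l2 (fun i => c * f i) = |c| * l2 f := by
  unfold l2
  simp only [mul_pow]
  rw [← Finset.mul_sum, Real.sqrt_mul (sq_nonneg c), Real.sqrt_sq_eq_abs]

theorem l2_mono {f g : ι → ℝ} (h : ∀ i, |f i| ≤ g i) : l2 f ≤ l2 g :=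
  Real.sqrt_le_sqrt (Finset.sum_le_sum fun i _ => sq_le_sq.2 ((h i).trans (le_abs_self _)))

/-- The `ℓ²` combination of a finite family of seminorms. -/
noncomputable def l2Seminorm {E : Type*} [AddCommGroup E] [Module ℝ E]
    (q : ι → Seminorm ℝ E) : Seminorm ℝ E :=
  Seminorm.of (fun z => l2 fun i => q i z)
    (fun x y => (l2_mono fun i => by
      rw [abs_of_nonneg (apply_nonneg _ _)]; exact map_add_le_add (q i) x y).trans
      (l2_add_le (fun i => q i x) (fun i => q i y)))
    (fun a x => by
      simp only [map_smul_eq_mul]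
      rw [l2_const_mul, abs_norm])

theorem l2Seminorm_apply {E : Type*} [AddCommGroup E] [Module ℝ E]
    (q : ι → Seminorm ℝ E) (z : E) : l2Seminorm q z = l2 fun i => q i z := rfl

end l2

section SmallBall
variable {E : Type*} [NormedAddCommGroup E] [InnerProductSpace ℝ E] [FiniteDimensional ℝ E]
  [MeasurableSpace E] [BorelSpace E]

theorem sq_le_exp_bound {w l : ℝ} (hl : log 2 ≤ l) (hw : 0 ≤ w) :
    w ^ 2 ≤ 9 + 8 * exp (l * (2 * w - 3)) := by
  rcases le_total w 3 with h | h
  · have := exp_pos (l * (2 * w - 3)); nlinarith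
  · have h1 : 4 ^ w / 8 ≤ exp (l * (2 * w - 3)) := by
      have e : (4 : ℝ) ^ w / 8 = exp (log 2 * (2 * w - 3)) := by
        have h4 : (4 : ℝ) = 2 ^ (2 : ℝ) := by norm_num
        rw [h4, ← Real.rpow_mul (by norm_num), mul_sub, Real.exp_sub,
          Real.rpow_def_of_pos (by norm_num)]
        congr 1
        rw [show log 2 * 3 = log (2 ^ (3 : ℝ)) by rw [Real.log_rpow (by norm_num)]; ring,
          Real.exp_log (by positivity)]
        norm_num
      rw [e]
      exact Real.exp_le_exp.2 (mul_le_mul_of_nonneg_right hl (by linarith))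
    have h2 : w ≤ 2 ^ w := by
      have := one_add_mul_self_le_rpow_one_add (s := (1 : ℝ)) (by norm_num) (p := w) (by linarith)
      norm_num at this
      linarith
    have h3 : w ^ 2 ≤ 4 ^ w := by
      have e : (4 : ℝ) ^ w = 2 ^ w * 2 ^ w := by
        rw [← Real.mul_rpow (by norm_num) (by norm_num)]; norm_num
      rw [e]; nlinarith
    linarith

theorem seminorm_sq_mul_gweight {κ : Type*} (P : Seminorm ℝ E) (T : Finset κ) (b : κ → E)
    (hP : ∀ x, P x = 0 ∨ ∃ j ∈ T, P x = |inner ℝ (b j) x|) {τ l : ℝ} (hτ : 0 < τ)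
    (hb : ∀ j ∈ T, ‖b j‖ ^ 2 ≤ τ) (hl : log 2 ≤ l) (hT : (T.card : ℝ) ≤ exp l) :
    Integrable (fun z => P z ^ 2 * gweight z) ∧
      ∫ z, P z ^ 2 * gweight z ≤ 25 * (τ * l) * ∫ z : E, gweight z := by
  have hl0 : 0 < l := lt_of_lt_of_le (Real.log_pos (by norm_num)) hl
  have hτl : 0 < τ * l := by positivity
  set s := √(τ * l) with hs
  have hs0 : 0 < s := Real.sqrt_pos.2 hτl
  have hs2 : s ^ 2 = τ * l := Real.sq_sqrt hτl.le
  set c : κ → E := fun j => (2 * l / s) • b j with hc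
  set F : E → ℝ := fun z => (τ * l) * (9 * gweight z + ∑ j ∈ T, 8 * exp (-(3 * l)) *
    (exp (inner ℝ (c j) z) * gweight z + exp (inner ℝ (-c j) z) * gweight z)) with hF
  have hFint : Integrable F := by
    refine Integrable.const_mul (Integrable.add (integrable_gweight.const_mul 9) ?_) _
    refine integrable_finsetSum _ fun j _ => Integrable.const_mul ?_ _
    exact (integrable_exp_inner_mul_gweight _).add (integrable_exp_inner_mul_gweight _)
  have hle : ∀ z, P z ^ 2 * gweight z ≤ F z := by
    intro z
    have hg := gweight_pos z
    have hnn : ∀ j ∈ T, 0 ≤ 8 * exp (-(3 * l)) *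
      (exp (inner ℝ (c j) z) * gweight z + exp (inner ℝ (-c j) z) * gweight z) := by
      intro j _; positivity
    rcases hP z with h | ⟨j, hj, h⟩
    · rw [h]
      have := Finset.sum_nonneg hnn
      simp only [hF]
      rw [zero_pow two_ne_zero, zero_mul]
      exact mul_nonneg hτl.le (by linarith)
    · have h1 := sq_le_exp_bound hl (w := |inner ℝ (b j) z| / s) (by positivity)
      have h2 : exp (l * (2 * (|inner ℝ (b j) z| / s) - 3)) ≤
          exp (-(3 * l)) * (exp (inner ℝ (c j) z) + exp (inner ℝ (-c j) z)) := by
        have e : l * (2 * (|inner ℝ (b j) z| / s) - 3) = -(3 * l) + |inner ℝ (c j) z| := by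
          simp only [hc, inner_smul_left, conj_trivial, abs_mul]
          rw [abs_of_nonneg (by positivity : 0 ≤ 2 * l / s)]; ring
        rw [e, Real.exp_add]
        refine mul_le_mul_of_nonneg_left ?_ (exp_pos _).le
        rw [inner_neg_left]
        exact Real.exp_abs_le _
      have h3 := Finset.single_le_sum hnn hj
      simp only [hF]
      rw [div_pow, hs2, div_le_iff₀ hτl] at h1
      rw [h]
      calc _ ≤ (9 + 8 * (exp (-(3 * l)) * (exp (inner ℝ (c j) z) + exp (inner ℝ (-c j) z)))) *
              (τ * l) * gweight z := by
            refine mul_le_mul_of_nonneg_right (h1.trans ?_) hg.le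
            gcongr
        _ = (τ * l) * (9 * gweight z + 8 * exp (-(3 * l)) *
              (exp (inner ℝ (c j) z) * gweight z + exp (inner ℝ (-c j) z) * gweight z)) := by ring
        _ ≤ _ := by gcongr
  have hint : Integrable (fun z => P z ^ 2 * gweight z) := by
    refine hFint.mono' ?_ (Filter.Eventually.of_forall fun z => ?_)
    · exact ((P.continuous_of_finrank.pow 2).mul gweight_continuous).aestronglyMeasurable
    · rw [Real.norm_of_nonneg (mul_nonneg (sq_nonneg _) (gweight_pos z).le)]; exact hle z
  refine ⟨hint, (integral_mono hint hFint hle).trans ?_⟩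
  have hI : 0 < ∫ z : E, gweight z := integral_gweight_pos
  set I := ∫ z : E, gweight z with hIdef
  have hFe : ∫ z, F z = (τ * l) * (9 * I + ∑ j ∈ T, 8 * exp (-(3 * l)) *
      (exp (‖c j‖ ^ 2 / 2) * I + exp (‖c j‖ ^ 2 / 2) * I)) := by
    simp only [hF]
    rw [integral_const_mul, integral_add (integrable_gweight.const_mul 9), integral_const_mul,
      integral_finsetSum]
    · congr 3
      ext j
      rw [integral_const_mul, integral_add (integrable_exp_inner_mul_gweight _)
        (integrable_exp_inner_mul_gweight _), integral_exp_inner_mul_gweight,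
        integral_exp_inner_mul_gweight, norm_neg]
    · exact fun j _ => ((integrable_exp_inner_mul_gweight _).add
        (integrable_exp_inner_mul_gweight _)).const_mul _
    · exact integrable_finsetSum _ fun j _ => ((integrable_exp_inner_mul_gweight _).add
        (integrable_exp_inner_mul_gweight _)).const_mul _
  rw [hFe]
  have hterm : ∀ j ∈ T, 8 * exp (-(3 * l)) *
      (exp (‖c j‖ ^ 2 / 2) * I + exp (‖c j‖ ^ 2 / 2) * I) ≤ 16 * exp (-l) * I := by
    intro j hj
    have h1 : ‖c j‖ ^ 2 / 2 ≤ 2 * l := by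
      simp only [hc, norm_smul, mul_pow, div_pow, Real.norm_eq_abs, sq_abs]
      rw [hs2]
      have := hb j hj
      have e : (2 : ℝ) ^ 2 * l ^ 2 / (τ * l) = 4 * l / τ := by field_simp; norm_num
      rw [e]
      have : 4 * l / τ * ‖b j‖ ^ 2 ≤ 4 * l / τ * τ := by gcongr
      have e2 : 4 * l / τ * τ = 4 * l := by field_simp
      linarith
    have h2 := Real.exp_le_exp.2 h1
    have e : exp (-l) = exp (-(3 * l)) * exp (2 * l) := by rw [← Real.exp_add]; ring_nf
    rw [e]
    have h3 : 0 < exp (-(3 * l)) := exp_pos _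
    calc _ = 16 * exp (-(3 * l)) * exp (‖c j‖ ^ 2 / 2) * I := by ring
      _ ≤ 16 * exp (-(3 * l)) * exp (2 * l) * I := by gcongr
      _ = _ := by ring
  have hs := Finset.sum_le_sum hterm
  rw [Finset.sum_const, nsmul_eq_mul] at hs
  have h5 : (T.card : ℝ) * exp (-l) ≤ 1 := by
    rw [Real.exp_neg, ← div_eq_mul_inv, div_le_one (exp_pos _)]; exact hT
  have h6 : (T.card : ℝ) * (16 * exp (-l) * I) ≤ 16 * I := by nlinarith
  calc _ ≤ (τ * l) * (9 * I + 16 * I) := by gcongr; linarith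
    _ = _ := by ring

theorem exists_coloring_of_groups {ι κ : Type*} [Fintype ι] (p : ι → Seminorm ℝ E)
    (S : ι → Finset κ) (b : ι → κ → E)
    (hp : ∀ i x, p i x = 0 ∨ ∃ j ∈ S i, p i x = |inner ℝ (b i j) x|) {τ l L : ℝ} (hτ : 0 < τ)
    (hb : ∀ i, ∀ j ∈ S i, ‖b i j‖ ^ 2 ≤ τ) (hl : log 2 ≤ l) (hL : log 2 ≤ L)
    (hS : ∀ i, ((S i).card : ℝ) ≤ exp l) (hT : (∑ i, (S i).card : ℝ) ≤ exp L)
    (w : ι → ℝ) (hw : ∀ i, 0 ≤ w i) (hw1 : ∑ i, w i ^ 2 ≤ 1)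
    (Y : Finset E) (c : E) {R s : ℝ} (hs : 0 < s) (hY : ∀ y ∈ Y, ‖y - c‖ ≤ R) :
    ∃ col : E → E, ((Y.image col).card : ℝ) ≤ 2 * exp ((R / s) ^ 2 / 2) ∧
      ∀ y ∈ Y, ∀ y' ∈ Y, col y = col y' →
        l2 (fun i => w i * p i (y - y')) ≤ 40 * s * √(τ * l) ∧
        ∀ i, p i (y - y') ≤ 40 * s * √(τ * L) := by
  have hl2 : 0 < log 2 := Real.log_pos (by norm_num)
  have hl0 : 0 < l := lt_of_lt_of_le hl2 hl
  have hL0 : 0 < L := lt_of_lt_of_le hl2 hL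
  set A := 10 * √(τ * l) with hA
  set B := 10 * √(τ * L) with hB
  have hA0 : 0 < A := by positivity
  have hB0 : 0 < B := by positivity
  have hA2 : A ^ 2 = 100 * (τ * l) := by rw [hA, mul_pow, Real.sq_sqrt (by positivity)]; norm_num
  have hB2 : B ^ 2 = 100 * (τ * L) := by rw [hB, mul_pow, Real.sq_sqrt (by positivity)]; norm_num
  set Q : Seminorm ℝ E := Finset.univ.sup p with hQ
  have hpQ : ∀ i z, p i z ≤ Q z := fun i z => Seminorm.le_finset_sup_apply (Finset.mem_univ i)
  have hQP : ∀ x, Q x = 0 ∨ ∃ a ∈ Finset.univ.sigma S, Q x = |inner ℝ (b a.1 a.2) x| := by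
    intro x
    rcases Seminorm.zero_or_exists_apply_eq_finset_sup p Finset.univ x with h | ⟨i, -, h⟩
    · exact Or.inl h
    · rcases hp i x with h' | ⟨j, hj, h'⟩
      · exact Or.inl (h.trans h')
      · exact Or.inr ⟨⟨i, j⟩, by simpa using hj, h.trans h'⟩
  obtain ⟨iQ, bQ⟩ := seminorm_sq_mul_gweight Q (Finset.univ.sigma S) (fun a => b a.1 a.2) hQP hτ
    (fun a ha => hb a.1 a.2 (Finset.mem_sigma.1 ha).2) hL
    (by rw [Finset.card_sigma]; push_cast; exact hT)
  have hi := fun i => seminorm_sq_mul_gweight (p i) (S i) (b i) (hp i) hτ (hb i) hl (hS i)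
  set N : Seminorm ℝ E := l2Seminorm (fun o : Option ι =>
    o.elim (Real.toNNReal B⁻¹ • Q)
      fun i => Real.toNNReal (w i / A) • p i) with hN
  have hN2 : ∀ z, N z ^ 2 = (Q z) ^ 2 / B ^ 2 + (∑ i, w i ^ 2 * p i z ^ 2) / A ^ 2 := by
    intro z
    rw [hN, l2Seminorm_apply, l2_sq, Fintype.sum_option]
    simp only [Option.elim, _root_.smul_apply, NNReal.smul_def, smul_eq_mul]
    congr 1
    · rw [Real.coe_toNNReal _ (by positivity), mul_pow, inv_pow]; ring
    · rw [Finset.sum_div]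
      refine Finset.sum_congr rfl fun i _ => ?_
      rw [Real.coe_toNNReal _ (div_nonneg (hw i) hA0.le), mul_pow, div_pow]; ring
  have hNc := N.continuous_of_finrank
  have hI : 0 < ∫ z : E, gweight z := integral_gweight_pos
  set I := ∫ z : E, gweight z with hIdef
  have hNint : Integrable (fun z => N z ^ 2 * gweight z) ∧
      ∫ z, N z ^ 2 * gweight z ≤ I / 2 := by
    have e : (fun z => N z ^ 2 * gweight z) = fun z => (B ^ 2)⁻¹ * (Q z ^ 2 * gweight z) +
        ∑ i, (w i ^ 2 / A ^ 2) * (p i z ^ 2 * gweight z) := by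
      ext z
      rw [hN2, add_mul]
      congr 1
      · ring
      · rw [Finset.sum_div, Finset.sum_mul]
        refine Finset.sum_congr rfl fun i _ => ?_
        ring
    have i2 : Integrable (fun z => ∑ i, (w i ^ 2 / A ^ 2) * (p i z ^ 2 * gweight z)) :=
      integrable_finsetSum _ fun i _ => (hi i).1.const_mul _
    rw [e]
    refine ⟨(iQ.const_mul _).add i2, ?_⟩
    rw [integral_add (iQ.const_mul _) i2, integral_const_mul, integral_finsetSum _
      fun i _ => (hi i).1.const_mul _]
    simp only [integral_const_mul]
    have b1 : (B ^ 2)⁻¹ * ∫ z, Q z ^ 2 * gweight z ≤ I / 4 := by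
      rw [inv_mul_le_iff₀ (by positivity), hB2]; linarith
    have b2 : ∑ i, w i ^ 2 / A ^ 2 * ∫ z, p i z ^ 2 * gweight z ≤ ∑ i, w i ^ 2 * (I / 4) := by
      refine Finset.sum_le_sum fun i _ => ?_
      rw [div_mul_eq_mul_div, mul_div_assoc]
      refine mul_le_mul_of_nonneg_left ?_ (sq_nonneg _)
      rw [div_le_iff₀ (by positivity), hA2]; linarith [(hi i).2]
    rw [← Finset.sum_mul] at b2
    nlinarith
  have hhalf : I / 2 ≤ ∫ z in {z : E | N z ≤ 1}, gweight z := by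
    have hm : MeasurableSet {z : E | N z ≤ 1} :=
      measurableSet_le hNc.measurable measurable_const
    have hsplit := integral_add_compl hm (integrable_gweight (E := E))
    have h1 : ∫ z in {z : E | N z ≤ 1}ᶜ, gweight z ≤ ∫ z in {z : E | N z ≤ 1}ᶜ,
        N z ^ 2 * gweight z := by
      refine setIntegral_mono_on integrable_gweight.integrableOn hNint.1.integrableOn hm.compl ?_
      intro z hz
      have h1 : 1 < N z := not_le.1 hz
      have h2 : 1 ≤ N z ^ 2 := by nlinarith
      exact le_mul_of_one_le_left (gweight_pos z).le h2
    have h2 := setIntegral_le_integral (s := {z : E | N z ≤ 1}ᶜ) hNint.1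
      (Filter.Eventually.of_forall fun z => mul_nonneg (sq_nonneg _) (gweight_pos z).le)
    linarith [hNint.2]
  obtain ⟨col, hcard, hcol⟩ := exists_coloring N hNc hhalf Y c hs hY
  refine ⟨col, hcard, fun y hy y' hy' h => ?_⟩
  have h1 := hcol y hy y' hy' h
  have h0 : 0 ≤ N (y - y') := apply_nonneg _ _
  have h2 : N (y - y') ^ 2 ≤ (4 * s) ^ 2 := pow_le_pow_left₀ h0 h1 2
  rw [hN2] at h2
  have t1 : 0 ≤ Q (y - y') ^ 2 / B ^ 2 := by positivity
  have t2 : 0 ≤ (∑ i, w i ^ 2 * p i (y - y') ^ 2) / A ^ 2 :=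
    div_nonneg (Finset.sum_nonneg fun i _ => by positivity) (by positivity)
  constructor
  · have h3 : (∑ i, w i ^ 2 * p i (y - y') ^ 2) / A ^ 2 ≤ (4 * s) ^ 2 := by linarith
    rw [div_le_iff₀ (by positivity), ← mul_pow] at h3
    unfold l2
    simp only [mul_pow]
    refine Real.sqrt_le_iff.2 ⟨by positivity, h3.trans (le_of_eq ?_)⟩
    rw [hA]; ring
  · intro i
    have h3 : Q (y - y') ^ 2 / B ^ 2 ≤ (4 * s) ^ 2 := by linarith
    rw [div_le_iff₀ (by positivity), ← mul_pow] at h3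
    have h4 := (pow_le_pow_iff_left₀ (apply_nonneg _ _) (by positivity) two_ne_zero).1 h3
    refine (hpQ i _).trans (h4.trans (le_of_eq ?_))
    rw [hB]; ring

end SmallBall

section Coordinate
variable {E : Type*} [AddCommGroup E] [Module ℝ E] (p : Seminorm ℝ E)

/-- A local proxy for `|p x ^ 2 - p y ^ 2|`. -/
noncomputable def qdist (x y : E) : ℝ := p (x - y) * max (p x) (p y)

theorem qdist_nonneg (x y : E) : 0 ≤ qdist p x y :=
  mul_nonneg (apply_nonneg _ _) (le_max_of_le_left (apply_nonneg _ _))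

theorem qdist_comm (x y : E) : qdist p x y = qdist p y x := by
  unfold qdist; rw [map_sub_rev, max_comm]

theorem qdist_self (x : E) : qdist p x x = 0 := by simp [qdist]

theorem seminorm_le_add_sub (x y : E) : p x ≤ p y + p (x - y) := by
  have := map_add_le_add p y (x - y)
  rwa [add_sub_cancel] at this

theorem qdist_triangle_aux (x y z : E) :
    p (x - z) * p x ≤ 4 * qdist p x y + 2 * qdist p y z ∨ p x < p z := by
  rcases lt_or_ge (p x) (p z) with h | h
  · exact Or.inr h
  left
  have hac : p (x - z) ≤ p (x - y) + p (y - z) := by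
    have := map_add_le_add p (x - y) (y - z); rwa [sub_add_sub_cancel] at this
  have h1 := seminorm_le_add_sub p x y
  have h2 := map_sub_le_add p y z
  have ha : 0 ≤ p (x - y) := apply_nonneg _ _
  have hb : 0 ≤ p (y - z) := apply_nonneg _ _
  have hx : 0 ≤ p x := apply_nonneg _ _
  have hy : 0 ≤ p y := apply_nonneg _ _
  have q1 : p (x - y) * p x ≤ qdist p x y := mul_le_mul_of_nonneg_left (le_max_left _ _) ha
  have q2 : p (y - z) * p y ≤ qdist p y z := mul_le_mul_of_nonneg_left (le_max_left _ _) hb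
  have h3 : p (x - z) * p x ≤ (p (x - y) + p (y - z)) * p x := mul_le_mul_of_nonneg_right hac hx
  rcases le_total (p x) (2 * p y) with h4 | h4
  · have : p (y - z) * p x ≤ p (y - z) * (2 * p y) := mul_le_mul_of_nonneg_left h4 hb
    have := qdist_nonneg p x y
    nlinarith
  · have h5 : p (y - z) ≤ 3 * p (x - y) := by linarith
    have : p (y - z) * p x ≤ 3 * p (x - y) * p x := mul_le_mul_of_nonneg_right h5 hx
    have := qdist_nonneg p y z
    nlinarith

theorem qdist_triangle (x y z : E) :
    qdist p x z ≤ 4 * (qdist p x y + qdist p y z) := by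
  have n1 := qdist_nonneg p x y
  have n2 := qdist_nonneg p y z
  rcases le_total (p z) (p x) with h | h
  · have e : qdist p x z = p (x - z) * p x := by unfold qdist; rw [max_eq_left h]
    rcases qdist_triangle_aux p x y z with h1 | h1
    · rw [e]; linarith
    · linarith
  · have e : qdist p x z = p (z - x) * p z := by
      unfold qdist; rw [max_eq_right h, map_sub_rev]
    rcases qdist_triangle_aux p z y x with h1 | h1
    · rw [e, qdist_comm p x y, qdist_comm p y z]
      rw [qdist_comm] at n1 n2
      linarith
    · linarith

theorem qdist_midpoint (x y y' : E) :
    qdist p x ((1 / 2 : ℝ) • (y + y')) ≤ 2 * (qdist p x y + qdist p x y') := by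
  have hm : p ((1 / 2 : ℝ) • (y + y')) ≤ (p y + p y') / 2 := by
    rw [map_smul_eq_mul]
    have := map_add_le_add p y y'
    norm_num; linarith
  have hd : p (x - (1 / 2 : ℝ) • (y + y')) ≤ (p (x - y) + p (x - y')) / 2 := by
    have e : x - (1 / 2 : ℝ) • (y + y') = (1 / 2 : ℝ) • ((x - y) + (x - y')) := by module
    rw [e, map_smul_eq_mul]
    have := map_add_le_add p (x - y) (x - y')
    norm_num; linarith
  have key : ∀ y y' : E, p (x - y) ≤ p (x - y') →
      (p (x - y) + p (x - y')) * (max (p x) (p y) + max (p x) (p y')) / 4 ≤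
        2 * (qdist p x y + qdist p x y') := by
    intro y y' h
    have h1 := seminorm_le_add_sub p y x
    rw [map_sub_rev] at h1
    have h2 := map_sub_le_add p x y'
    have hx : 0 ≤ p x := apply_nonneg _ _
    have ha : 0 ≤ p (x - y) := apply_nonneg _ _
    have m1 : p x ≤ max (p x) (p y') := le_max_left _ _
    have m2 : p y' ≤ max (p x) (p y') := le_max_right _ _
    have m3 : max (p x) (p y) ≤ 3 * max (p x) (p y') := max_le (by linarith) (by linarith)
    have q1 : p (x - y) * max (p x) (p y') ≤ p (x - y') * max (p x) (p y') :=
      mul_le_mul_of_nonneg_right h (hx.trans m1)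
    have q2 : p (x - y') * max (p x) (p y) ≤ p (x - y') * (3 * max (p x) (p y')) :=
      mul_le_mul_of_nonneg_left m3 (ha.trans h)
    have n1 := qdist_nonneg p x y
    have n2 := qdist_nonneg p x y'
    unfold qdist at *
    nlinarith
  have hle : qdist p x ((1 / 2 : ℝ) • (y + y')) ≤
      (p (x - y) + p (x - y')) * (max (p x) (p y) + max (p x) (p y')) / 4 := by
    have hmax : max (p x) (p ((1 / 2 : ℝ) • (y + y'))) ≤
        (max (p x) (p y) + max (p x) (p y')) / 2 := by
      have m1 := le_max_left (p x) (p y)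
      have m2 := le_max_right (p x) (p y)
      have m3 := le_max_left (p x) (p y')
      have m4 := le_max_right (p x) (p y')
      exact max_le (by linarith) (by linarith)
    have := mul_le_mul hd hmax (le_max_of_le_left (apply_nonneg _ _))
      ((apply_nonneg p _).trans hd)
    unfold qdist
    linarith
  refine hle.trans ?_
  rcases le_total (p (x - y)) (p (x - y')) with h | h
  · exact key y y' h
  · have := key y' y h
    linarith

theorem abs_sq_sub_sq_le_qdist (x y : E) : |p x ^ 2 - p y ^ 2| ≤ 2 * qdist p x y := by
  have h1 := seminorm_le_add_sub p x y
  have h2 := seminorm_le_add_sub p y x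
  rw [map_sub_rev] at h2
  have hx : 0 ≤ p x := apply_nonneg _ _
  have hy : 0 ≤ p y := apply_nonneg _ _
  have ha : 0 ≤ p (x - y) := apply_nonneg _ _
  have m1 : p (x - y) * p x ≤ qdist p x y := mul_le_mul_of_nonneg_left (le_max_left _ _) ha
  have m2 : p (x - y) * p y ≤ qdist p x y := mul_le_mul_of_nonneg_left (le_max_right _ _) ha
  rw [abs_le]
  constructor <;> nlinarith

theorem min_sq_le_qdist (x y : E) {h : ℝ} (hh : 0 ≤ h) :
    min (p y ^ 2) h ≤ 2 * qdist p x y + 4 * min (p x ^ 2) h := by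
  have hy : 0 ≤ p y := apply_nonneg _ _
  have hx : 0 ≤ p x := apply_nonneg _ _
  have hq := qdist_nonneg p x y
  rcases le_total (p y) (2 * p x) with h1 | h1
  · have : min (p y ^ 2) h ≤ 4 * min (p x ^ 2) h := by
      rw [mul_min_of_nonneg _ _ (by norm_num)]
      exact min_le_min (by nlinarith) (by linarith)
    linarith
  · have h2 := seminorm_le_add_sub p y x
    rw [map_sub_rev] at h2
    have h3 : p (x - y) * p y ≤ qdist p x y :=
      mul_le_mul_of_nonneg_left (le_max_right _ _) (apply_nonneg _ _)
    have h4 : p y ^ 2 ≤ 2 * qdist p x y := by nlinarith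
    have : 0 ≤ min (p x ^ 2) h := le_min (sq_nonneg _) hh
    exact (min_le_left _ _).trans (by linarith)

theorem qdist_cover_aux (x y y' xb : E) {η K : ℝ} (hK : 0 < K)
    (hz : p (y - y') ≤ η) (hyy : p y' ≤ p y) :
    p (y - y') * p y ≤ 2 * (p xb * p (y - y')) + 2 / K * qdist p y xb +
      4 * qdist p x y + 8 * min (p x ^ 2) ((K * η) ^ 2) := by
  have hy : 0 ≤ p y := apply_nonneg _ _
  have hxb : 0 ≤ p xb := apply_nonneg _ _
  have hz0 : 0 ≤ p (y - y') := apply_nonneg _ _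
  have hq := qdist_nonneg p x y
  have hq' : 0 ≤ 2 / K * qdist p y xb := mul_nonneg (by positivity) (qdist_nonneg p y xb)
  have hm : 0 ≤ min (p x ^ 2) ((K * η) ^ 2) := by positivity
  rcases le_total (p y) (2 * p xb) with h1 | h1
  · nlinarith [mul_le_mul_of_nonneg_left h1 hz0]
  rcases le_total (K * η) (p y) with h2 | h2
  · have h3 := seminorm_le_add_sub p y xb
    have h4 : p (y - xb) * p y ≤ qdist p y xb :=
      mul_le_mul_of_nonneg_left (le_max_left _ _) (apply_nonneg _ _)
    have h5 : p y ^ 2 ≤ 2 * qdist p y xb := by nlinarith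
    have h6 : p (y - y') * p y ≤ 2 / K * qdist p y xb := by
      rw [div_mul_eq_mul_div, le_div_iff₀ hK]
      calc p (y - y') * p y * K ≤ η * p y * K := by gcongr
        _ = (K * η) * p y := by ring
        _ ≤ p y * p y := by gcongr
        _ ≤ _ := by linarith
    have := mul_nonneg hxb hz0
    linarith
  · have h3 := map_sub_le_add p y y'
    have h4 := min_sq_le_qdist p x y (sq_nonneg (K * η))
    rw [min_eq_left (pow_le_pow_left₀ hy h2 2)] at h4
    have := mul_nonneg hxb hz0
    nlinarith

theorem qdist_cover (x x' y y' xb : E) {η K : ℝ} (hK : 0 < K)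
    (hz : p (y - y') ≤ η) :
    qdist p y y' ≤ 2 * (p xb * p (y - y')) + 2 / K * (qdist p y xb + qdist p y' xb) +
      4 * (qdist p x y + qdist p x' y') +
      8 * (min (p x ^ 2) ((K * η) ^ 2) + min (p x' ^ 2) ((K * η) ^ 2)) := by
  have n1 := qdist_nonneg p x y
  have n2 := qdist_nonneg p x' y'
  have n3 : 0 ≤ 2 / K * qdist p y xb := mul_nonneg (by positivity) (qdist_nonneg p y xb)
  have n4 : 0 ≤ 2 / K * qdist p y' xb := mul_nonneg (by positivity) (qdist_nonneg p y' xb)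
  have m1 : 0 ≤ min (p x ^ 2) ((K * η) ^ 2) := by positivity
  have m2 : 0 ≤ min (p x' ^ 2) ((K * η) ^ 2) := by positivity
  rw [mul_add (2 / K)]
  rcases le_total (p y') (p y) with h | h
  · have := qdist_cover_aux p x y y' xb hK hz h
    have e : qdist p y y' = p (y - y') * p y := by unfold qdist; rw [max_eq_left h]
    rw [e]; linarith
  · have := qdist_cover_aux p x' y' y xb hK (η := η) (by rwa [map_sub_rev]) h
    have e : qdist p y y' = p (y' - y) * p y' := by
      unfold qdist; rw [max_eq_right h, map_sub_rev]
    rw [e, map_sub_rev p y y']; linarith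

end Coordinate

section Rho
variable {ι : Type*} [Fintype ι] {E : Type*} [AddCommGroup E] [Module ℝ E]
  (p : ι → Seminorm ℝ E)

/-- The quasi-metric controlling the increments of `x ↦ ∑ i, ± p i x ^ 2`. -/
noncomputable def rho (x y : E) : ℝ := l2 fun i => qdist (p i) x y

/-- The `ℓ²` norm of the truncated squares `min (p i x ^ 2) h`. -/
noncomputable def trunc (h : ℝ) (x : E) : ℝ := l2 fun i => min (p i x ^ 2) h

theorem rho_nonneg (x y : E) : 0 ≤ rho p x y := l2_nonneg _

theorem rho_comm (x y : E) : rho p x y = rho p y x := by simp only [rho, qdist_comm]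

theorem rho_self (x : E) : rho p x x = 0 := by simp [rho, qdist_self, l2]

theorem l2_le_of_le_const_mul_add {f g h : ι → ℝ} (hf : ∀ i, 0 ≤ f i) {c : ℝ} (hc : 0 ≤ c)
    (hle : ∀ i, f i ≤ c * (g i + h i)) : l2 f ≤ c * (l2 g + l2 h) := by
  have h1 : l2 f ≤ l2 fun i => c * (g i + h i) :=
    l2_mono fun i => by rw [abs_of_nonneg (hf i)]; exact hle i
  rw [l2_const_mul, abs_of_nonneg hc] at h1
  exact h1.trans (mul_le_mul_of_nonneg_left (l2_add_le g h) hc)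

theorem rho_triangle (x y z : E) : rho p x z ≤ 4 * (rho p x y + rho p y z) :=
  l2_le_of_le_const_mul_add (fun i => qdist_nonneg _ _ _) (by norm_num)
    fun i => qdist_triangle (p i) x y z

theorem rho_midpoint (x y y' : E) :
    rho p x ((1 / 2 : ℝ) • (y + y')) ≤ 2 * (rho p x y + rho p x y') :=
  l2_le_of_le_const_mul_add (fun i => qdist_nonneg _ _ _) (by norm_num)
    fun i => qdist_midpoint (p i) x y y'

theorem l2_sq_sub_sq_le_rho (x y : E) :
    l2 (fun i => p i x ^ 2 - p i y ^ 2) ≤ 2 * rho p x y := by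
  have := l2_mono (f := fun i => p i x ^ 2 - p i y ^ 2) (g := fun i => 2 * qdist (p i) x y)
    fun i => abs_sq_sub_sq_le_qdist (p i) x y
  rwa [l2_const_mul, abs_of_nonneg (by norm_num : (0 : ℝ) ≤ 2)] at this

theorem rho_cover {x x' y y' xb : E} {η u Δ D I : ℝ}
    (hz : ∀ i, p i (y - y') ≤ η) (hu : l2 (fun i => p i xb * p i (y - y')) ≤ u)
    (hx : rho p x xb ≤ Δ) (hx' : rho p x' xb ≤ Δ) (hD : rho p x y ≤ D) (hD' : rho p x' y' ≤ D)
    (hI : trunc p ((2 ^ 14 * η) ^ 2) x ≤ I) (hI' : trunc p ((2 ^ 14 * η) ^ 2) x' ≤ I) :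
    rho p x x' ≤ 148 * D + 32 * u + (Δ + D) / 64 + 256 * I := by
  have h1 : rho p y y' ≤ 2 * u + 2 / 2 ^ 14 * (rho p y xb + rho p y' xb) +
      4 * (rho p x y + rho p x' y') +
      8 * (trunc p ((2 ^ 14 * η) ^ 2) x + trunc p ((2 ^ 14 * η) ^ 2) x') := by
    have := l2_mono (f := fun i => qdist (p i) y y') (g := fun i =>
        2 * (p i xb * p i (y - y')) + 2 / 2 ^ 14 * (qdist (p i) y xb + qdist (p i) y' xb) +
        4 * (qdist (p i) x y + qdist (p i) x' y') +
        8 * (min (p i x ^ 2) ((2 ^ 14 * η) ^ 2) + min (p i x' ^ 2) ((2 ^ 14 * η) ^ 2)))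
        fun i => by
      rw [abs_of_nonneg (qdist_nonneg _ _ _)]
      exact qdist_cover (p i) x x' y y' xb (by norm_num : (0 : ℝ) < 2 ^ 14) (hz i)
    refine this.trans ((l2_add_le _ _).trans ?_)
    refine add_le_add ((l2_add_le _ _).trans (add_le_add ((l2_add_le _ _).trans
      (add_le_add ?_ ?_)) ?_)) ?_
    · rw [l2_const_mul, abs_of_nonneg (by norm_num : (0 : ℝ) ≤ 2)]
      linarith
    all_goals
      rw [l2_const_mul, abs_of_nonneg (by norm_num)]
      exact mul_le_mul_of_nonneg_left (l2_add_le _ _) (by norm_num)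
  have h2 := rho_triangle p y x xb
  have h3 := rho_triangle p y' x' xb
  rw [rho_comm p y x] at h2
  rw [rho_comm p y' x'] at h3
  have h4 := rho_triangle p x y x'
  have h5 := rho_triangle p y y' x'
  rw [rho_comm p y' x'] at h5
  generalize trunc p ((2 ^ 14 * η) ^ 2) x = a at *
  generalize trunc p ((2 ^ 14 * η) ^ 2) x' = b at *
  norm_num at h1
  linarith

end Rho

theorem sum_min_div_le (H : ℕ → ℝ) (hpos : ∀ k, 0 < H k) (hH : ∀ k, H (k + 1) ≤ H k / 2)
    {b : ℝ} (hb : 0 ≤ b) (N : ℕ) :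
    ∑ k ∈ Finset.range N, min (b / H k) (H k / b) ≤ 5 := by
  rcases hb.eq_or_lt with rfl | hb
  · simp
  have key : ∀ N, ∑ k ∈ Finset.range (N + 1), min (b / H k) (H k / b) ≤
      if b ≤ H N then 2 * (b / H N) else 5 - 2 * (H N / b) := by
    intro N
    induction N with
    | zero =>
      simp only [zero_add, Finset.sum_range_one]
      split_ifs with h
      · have : 0 ≤ b / H 0 := (div_pos hb (hpos 0)).le
        exact (min_le_left _ _).trans (by linarith)
      · have : H 0 / b ≤ 1 := (div_le_one hb).2 (not_le.1 h).le
        exact (min_le_right _ _).trans (by linarith)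
    | succ N ih =>
      rw [Finset.sum_range_succ]
      have h1 := hH N
      have p0 := hpos N
      have p1 := hpos (N + 1)
      by_cases h : b ≤ H (N + 1)
      · rw [if_pos (by linarith)] at ih
        rw [if_pos h]
        have h2 : b / H N ≤ b / H (N + 1) / 2 := by
          rw [div_div]
          exact div_le_div_of_nonneg_left hb.le (by positivity) (by linarith)
        have := min_le_left (b / H (N + 1)) (H (N + 1) / b)
        linarith
      · rw [if_neg h]
        push Not at h
        have h3 : H (N + 1) / b ≤ 1 := (div_le_one hb).2 h.le
        have h4 := min_le_right (b / H (N + 1)) (H (N + 1) / b)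
        split_ifs at ih with h5
        · have : b / H N ≤ 1 := (div_le_one p0).2 h5
          linarith
        · have h6 : H (N + 1) / b ≤ H N / b / 2 := by
            rw [div_right_comm]; exact div_le_div_of_nonneg_right h1 hb.le
          have : 0 ≤ H (N + 1) / b := (div_pos p1 hb).le
          linarith
  cases N with
  | zero => simp
  | succ N =>
    refine (key N).trans ?_
    split_ifs with h
    · have : b / H N ≤ 1 := (div_le_one (hpos N)).2 h
      linarith
    · have : 0 ≤ H N / b := (div_pos (hpos N) hb).le
      linarith

section Interp
variable {ι : Type*} [Fintype ι] {E : Type*} [NormedAddCommGroup E] [InnerProductSpace ℝ E]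
  [FiniteDimensional ℝ E] (p : ι → Seminorm ℝ E)

theorem rho_continuous_right (x : E) : Continuous fun y => rho p x y := by
  unfold rho l2 qdist
  refine Real.continuous_sqrt.comp (continuous_finsetSum _ fun i _ => ?_)
  have := (p i).continuous_of_finrank
  fun_prop

theorem exists_argmin (t : ℝ) (x : E) : ∃ y ∈ Metric.closedBall (0 : E) 2,
    ∀ z ∈ Metric.closedBall (0 : E) 2, ‖y‖ ^ 2 + t * rho p x y ≤ ‖z‖ ^ 2 + t * rho p x z := by
  have := rho_continuous_right p x
  obtain ⟨y, hy, h⟩ := (isCompact_closedBall (0 : E) 2).exists_isMinOn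
    (f := fun y => ‖y‖ ^ 2 + t * rho p x y) ⟨0, by simp⟩ (by fun_prop)
  exact ⟨y, hy, fun z hz => h hz⟩

theorem exists_interpolants {t₀ : ℝ} (ht : 0 < t₀) : ∃ y : ℕ → E → E, ∀ x, ‖x‖ ^ 2 ≤ 2 →
    (∀ k, t₀ * 2 ^ k * rho p x (y k x) ≤ 2) ∧
    (∀ k, rho p x (y (k + 1) x) ≤ rho p x (y k x)) ∧
    (∀ N, ∑ k ∈ Finset.range N, t₀ * 2 ^ k * rho p x (y k x) ≤ 4) ∧
    ∀ x', ‖x'‖ ^ 2 ≤ 2 → ∀ k Δ D, rho p x x' ≤ Δ → rho p x (y k x) ≤ D →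
      rho p x' (y k x') ≤ D → ‖y k x - y k x'‖ ^ 2 ≤ 40 * (t₀ * 2 ^ k) * (Δ + D) := by
  choose y hy hmin using fun k : ℕ => exists_argmin p (t₀ * 2 ^ k)
  have hball : ∀ x : E, ‖x‖ ^ 2 ≤ 2 → x ∈ Metric.closedBall (0 : E) 2 := by
    intro x hx
    rw [mem_closedBall_zero_iff]
    nlinarith [norm_nonneg x]
  refine ⟨y, fun x hx => ?_⟩
  have hV : ∀ k, ‖y k x‖ ^ 2 + t₀ * 2 ^ k * rho p x (y k x) ≤ 2 := by
    intro k
    have := hmin k x x (hball x hx)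
    rw [rho_self] at this
    linarith
  have hstep : ∀ k, ‖y k x‖ ^ 2 + t₀ * 2 ^ k * rho p x (y k x) ≤
      ‖y (k + 1) x‖ ^ 2 + t₀ * 2 ^ k * rho p x (y (k + 1) x) :=
    fun k => hmin k x _ (hy (k + 1) x)
  refine ⟨fun k => ?_, fun k => ?_, fun N => ?_, ?_⟩
  · have := hV k
    have := sq_nonneg ‖y k x‖
    linarith
  · have h1 := hstep k
    have h2 := hmin (k + 1) x _ (hy k x)
    have h3 : 0 < t₀ * 2 ^ k := by positivity
    have e : t₀ * 2 ^ (k + 1) = 2 * (t₀ * 2 ^ k) := by ring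
    rw [e] at h2
    nlinarith
  · have key : ∀ N, ∑ k ∈ Finset.range (N + 1), t₀ * 2 ^ k * rho p x (y k x) ≤
        2 * (‖y N x‖ ^ 2 + t₀ * 2 ^ N * rho p x (y N x)) := by
      intro N
      induction N with
      | zero =>
        have : 0 ≤ t₀ * rho p x (y 0 x) := mul_nonneg ht.le (rho_nonneg _ _ _)
        have := sq_nonneg ‖y 0 x‖
        simp only [zero_add, Finset.sum_range_one, pow_zero, mul_one]
        linarith
      | succ N ih =>
        rw [Finset.sum_range_succ]
        have h1 := hstep N
        have e : t₀ * 2 ^ (N + 1) = 2 * (t₀ * 2 ^ N) := by ring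
        rw [e]
        linarith
    cases N with
    | zero => simp
    | succ N => exact (key N).trans (by linarith [hV N])
  · intro x' hx' k Δ D hΔ hD hD'
    set t := t₀ * 2 ^ k with htdef
    have htpos : 0 < t := by positivity
    set a := y k x
    set a' := y k x'
    set m := (1 / 2 : ℝ) • (a + a') with hm
    have hmb : m ∈ Metric.closedBall (0 : E) 2 := by
      have h1 := hy k x
      have h2 := hy k x'
      rw [mem_closedBall_zero_iff] at *
      rw [hm, norm_smul]
      have := norm_add_le a a'
      norm_num
      linarith
    have h1 := hmin k x m hmb
    have h2 := hmin k x' m hmb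
    have par : ‖m‖ ^ 2 = (‖a‖ ^ 2 + ‖a'‖ ^ 2) / 2 - ‖a - a'‖ ^ 2 / 4 := by
      rw [hm, norm_smul, mul_pow, norm_add_sq_real, norm_sub_sq_real]
      norm_num
      ring
    have m1 := rho_midpoint p x a a'
    have m2 := rho_midpoint p x' a a'
    have r1 := rho_triangle p x x' a'
    have r2 := rho_triangle p x' x a
    rw [rho_comm p x' x] at r2
    have n1 := rho_nonneg p x a
    have n2 := rho_nonneg p x' a'
    have b1 : t * rho p x m ≤ t * (10 * D + 8 * Δ) :=
      mul_le_mul_of_nonneg_left (by linarith) htpos.le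
    have b2 : t * rho p x' m ≤ t * (10 * D + 8 * Δ) :=
      mul_le_mul_of_nonneg_left (by linarith) htpos.le
    have c1 : 0 ≤ t * rho p x a := mul_nonneg htpos.le n1
    have c2 : 0 ≤ t * rho p x' a' := mul_nonneg htpos.le n2
    have c3 : 0 ≤ t * Δ := mul_nonneg htpos.le ((rho_nonneg _ _ _).trans hΔ)
    nlinarith
end Interp

theorem exists_representatives {α K : Type*} (T : Finset α) (key : α → K) :
    ∃ L : α → α, (∀ x ∈ T, L x ∈ T) ∧ (∀ x ∈ T, key (L x) = key x) ∧
      (∀ x ∈ T, ∀ x' ∈ T, L x = L x' ↔ key x = key x') ∧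
      (T.image L).card ≤ (T.image key).card := by
  have h : ∀ k : K, ∃ f : α → α, ∀ x ∈ T, key x = k → f x ∈ T ∧ key (f x) = k ∧
      ∀ x' ∈ T, key x' = k → f x = f x' := by
    intro k
    by_cases hk : ∃ x₀ ∈ T, key x₀ = k
    · obtain ⟨x₀, h₀, h₁⟩ := hk
      exact ⟨fun _ => x₀, fun x _ _ => ⟨h₀, h₁, fun _ _ _ => rfl⟩⟩
    · push Not at hk
      exact ⟨id, fun x hx hxk => absurd hxk (hk x hx)⟩
  choose f hf using h
  have hiff : ∀ x ∈ T, ∀ x' ∈ T, f (key x) x = f (key x') x' ↔ key x = key x' := by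
    intro x hx x' hx'
    constructor
    · intro e
      rw [← (hf _ x hx rfl).2.1, e, (hf _ x' hx' rfl).2.1]
    · intro e
      have := (hf _ x hx rfl).2.2 x' hx' e.symm
      rw [this, e]
  refine ⟨fun x => f (key x) x, fun x hx => (hf _ x hx rfl).1, fun x hx => (hf _ x hx rfl).2.1,
    hiff, ?_⟩
  refine Finset.card_le_card_of_injOn key ?_ ?_
  · intro z hz
    obtain ⟨x, hx, rfl⟩ := Finset.mem_image.1 hz
    exact Finset.mem_image_of_mem key (hf _ x hx rfl).1
  · intro z hz z' hz' e
    obtain ⟨x, hx, rfl⟩ := Finset.mem_image.1 hz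
    obtain ⟨x', hx', rfl⟩ := Finset.mem_image.1 hz'
    rw [(hf _ x hx rfl).2.1, (hf _ x' hx' rfl).2.1] at e
    exact (hiff x hx x' hx').2 e

/-- `L` selects representatives of a partition of `T` whose cells have `rho`-diameter at
most `δ`. -/
structure IsNet {ι E : Type*} [Fintype ι] [AddCommGroup E] [Module ℝ E]
    (p : ι → Seminorm ℝ E) (T : Finset E) (L : E → E) (δ : E → ℝ) : Prop where
  mem : ∀ x ∈ T, L x ∈ T
  idem : ∀ x ∈ T, L (L x) = L x
  const : ∀ x ∈ T, δ (L x) = δ x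
  le : ∀ x ∈ T, ∀ x' ∈ T, L x = L x' → rho p x x' ≤ δ x

theorem IsNet.nonneg {ι E : Type*} [Fintype ι] [AddCommGroup E] [Module ℝ E]
    {p : ι → Seminorm ℝ E} {T : Finset E} {L : E → E} {δ : E → ℝ} (h : IsNet p T L δ) {x : E}
    (hx : x ∈ T) : 0 ≤ δ x :=
  (rho_nonneg _ _ _).trans (h.le x hx x hx rfl)

theorem trunc_mono {ι E : Type*} [Fintype ι] [AddCommGroup E] [Module ℝ E]
    (p : ι → Seminorm ℝ E) {h h' : ℝ} (h0 : 0 ≤ h) (hh : h ≤ h') (x : E) :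
    trunc p h x ≤ trunc p h' x := by
  refine l2_mono fun i => ?_
  rw [abs_of_nonneg (le_min (sq_nonneg _) h0)]
  exact min_le_min_left _ hh

section Refine
variable {E : Type*} [NormedAddCommGroup E] [InnerProductSpace ℝ E] [FiniteDimensional ℝ E]
  [MeasurableSpace E] [BorelSpace E]

theorem exists_refinement {ι κ : Type*} [Fintype ι] (p : ι → Seminorm ℝ E)
    (S : ι → Finset κ) (b : ι → κ → E)
    (hp : ∀ i x, p i x = 0 ∨ ∃ j ∈ S i, p i x = |inner ℝ (b i j) x|) {τ l L : ℝ} (hτ : 0 < τ)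
    (hb : ∀ i, ∀ j ∈ S i, ‖b i j‖ ^ 2 ≤ τ) (hl : log 2 ≤ l) (hL : log 2 ≤ L)
    (hS : ∀ i, ((S i).card : ℝ) ≤ exp l) (hT : (∑ i, (S i).card : ℝ) ≤ exp L)
    (T : Finset E) (hT1 : ∀ x ∈ T, ∑ i, p i x ^ 2 ≤ 1) {t s fl : ℝ} (ht : 0 < t) (hs : 0 < s)
    (hfl : 0 < fl) (y : E → E)
    (hy : ∀ x ∈ T, ∀ x' ∈ T, ∀ Δ D, rho p x x' ≤ Δ → rho p x (y x) ≤ D →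
      rho p x' (y x') ≤ D → ‖y x - y x'‖ ^ 2 ≤ 40 * t * (Δ + D))
    (r : E → E) (δ : E → ℝ) (hnet : IsNet p T r δ) (I : E → ℝ) (hI0 : ∀ x ∈ T, 0 ≤ I x)
    (hI : ∀ x ∈ T, trunc p
      ((2 ^ 14 * 40) ^ 2 * (40 * t * (δ x + rho p x (y x) + fl) / s ^ 2) * (τ * L)) x ≤ I x)
    (B : ℕ) (hB : ∀ x ∈ T, rho p x (y x) < B * fl) (hB' : ∀ x ∈ T, I x < B * fl) :
    ∃ (r' : E → E) (δ' : E → ℝ), IsNet p T r' δ' ∧ (∀ x ∈ T, r (r' x) = r x) ∧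
      (∀ x ∈ T, δ' x ≤ δ x) ∧
      (∀ x ∈ T, δ' x ≤ 148 * (rho p x (y x) + fl) +
        1280 * (√(40 * t * (δ x + rho p x (y x) + fl)) / s) * √(τ * l) +
        (δ x + rho p x (y x) + fl) / 64 + 256 * (I x + fl)) ∧
      ((T.image r').card : ℝ) ≤ (T.image r).card * B ^ 2 * (2 * exp (s ^ 2 / 2)) := by
  set bD : E → ℕ := fun x => ⌊rho p x (y x) / fl⌋₊ with hbD
  set bI : E → ℕ := fun x => ⌊I x / fl⌋₊ with hbI
  have bD_lt : ∀ x, rho p x (y x) ≤ (bD x + 1) * fl := fun x => by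
    rw [← div_le_iff₀ hfl]; exact (Nat.lt_floor_add_one _).le
  have bI_lt : ∀ x, I x ≤ (bI x + 1) * fl := fun x => by
    rw [← div_le_iff₀ hfl]; exact (Nat.lt_floor_add_one _).le
  have bD_le : ∀ x, (bD x + 1) * fl ≤ rho p x (y x) + fl := fun x => by
    have h : (bD x : ℝ) ≤ rho p x (y x) / fl :=
      Nat.floor_le (div_nonneg (rho_nonneg _ _ _) hfl.le)
    rw [le_div_iff₀ hfl] at h; linarith
  have bI_le : ∀ x ∈ T, (bI x + 1) * fl ≤ I x + fl := fun x hx => by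
    have h : (bI x : ℝ) ≤ I x / fl := Nat.floor_le (div_nonneg (hI0 x hx) hfl.le)
    rw [le_div_iff₀ hfl] at h; linarith
  set g : E → E × ℕ × ℕ := fun x => (r x, bD x, bI x) with hg
  set R : E × ℕ × ℕ → ℝ := fun k => √(40 * t * (δ k.1 + (k.2.1 + 1) * fl)) with hR
  have hcol : ∀ k : E × ℕ × ℕ, ∃ col : E → E,
      ((((T.filter fun x => g x = k).image y).image col).card : ℝ) ≤ 2 * exp (s ^ 2 / 2) ∧
      ∀ x ∈ T, ∀ x' ∈ T, g x = k → g x' = k → col (y x) = col (y x') →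
        l2 (fun i => p i k.1 * p i (y x - y x')) ≤ 40 * (R k / s) * √(τ * l) ∧
        ∀ i, p i (y x - y x') ≤ 40 * (R k / s) * √(τ * L) := by
    intro k
    by_cases hk : ∃ x₀ ∈ T, g x₀ = k
    · obtain ⟨x₀, h₀, rfl⟩ := hk
      have hc : r x₀ ∈ T := hnet.mem x₀ h₀
      have hδ0 : 0 ≤ δ (r x₀) := hnet.nonneg hc
      have hRpos : 0 < R (g x₀) := by
        simp only [hR, hg]
        positivity
      obtain ⟨col, h1, h2⟩ := exists_coloring_of_groups p S b hp hτ hb hl hL hS hT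
        (fun i => p i (r x₀)) (fun i => apply_nonneg _ _) (hT1 _ hc)
        ((T.filter fun x => g x = g x₀).image y) (y x₀) (R := R (g x₀)) (s := R (g x₀) / s)
        (by positivity) (by
          intro z hz
          obtain ⟨x, hx, rfl⟩ := Finset.mem_image.1 hz
          obtain ⟨hxT, hxg⟩ := Finset.mem_filter.1 hx
          simp only [hg, Prod.mk.injEq] at hxg
          refine Real.le_sqrt_of_sq_le (hy x hxT x₀ h₀ _ _ ?_ ?_ (bD_lt x₀))
          · change _ ≤ δ (r x₀)
            rw [← hxg.1, hnet.const x hxT]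
            exact hnet.le x hxT x₀ h₀ hxg.1
          · simp only [hg]; rw [← hxg.2.1]; exact bD_lt x)
      refine ⟨col, ?_, ?_⟩
      · rwa [div_div_cancel₀ hRpos.ne'] at h1
      · intro x hx x' hx' e e' hcc
        exact h2 _ (Finset.mem_image_of_mem y (Finset.mem_filter.2 ⟨hx, e⟩)) _
          (Finset.mem_image_of_mem y (Finset.mem_filter.2 ⟨hx', e'⟩)) hcc
    · push Not at hk
      refine ⟨id, ?_, fun x hx _ _ e => absurd e (hk x hx)⟩
      rw [Finset.filter_false_of_mem fun x hx => hk x hx]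
      simp
      positivity
  choose col hcard hcol using hcol
  set key : E → (E × ℕ × ℕ) × E := fun x => (g x, col (g x) (y x)) with hkey
  obtain ⟨r', hr'T, hr'key, hr'iff, hr'card⟩ := exists_representatives T key
  set U : E × ℕ × ℕ → ℝ := fun k => 148 * ((k.2.1 + 1) * fl) +
    32 * (40 * (R k / s) * √(τ * l)) + (δ k.1 + (k.2.1 + 1) * fl) / 64 +
    256 * ((k.2.2 + 1) * fl) with hU
  have hg_eq : ∀ x ∈ T, g (r' x) = g x := fun x hx => congrArg Prod.fst (hr'key x hx)
  refine ⟨r', fun x => min (δ (r x)) (U (g x)), ⟨hr'T, fun x hx => ?_, fun x hx => ?_, ?_⟩,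
    fun x hx => congrArg Prod.fst (hg_eq x hx), fun x hx => ?_, fun x hx => ?_, ?_⟩
  · exact (hr'iff _ (hr'T x hx) _ hx).2 (hr'key x hx)
  · have h1 := hg_eq x hx
    have h2 : r (r' x) = r x := congrArg Prod.fst h1
    simp only [h1, h2]
  · intro x hx x' hx' e
    have hk := (hr'iff x hx x' hx').1 e
    simp only [hkey, Prod.mk.injEq] at hk
    obtain ⟨hgx, hc⟩ := hk
    have hgx' := hgx
    simp only [hg, Prod.mk.injEq] at hgx'
    obtain ⟨e1, e2, e3⟩ := hgx'
    have hrx : r x ∈ T := hnet.mem x hx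
    refine le_min ?_ ?_
    · rw [hnet.const x hx]; exact hnet.le x hx x' hx' e1
    rw [← hgx] at hc
    obtain ⟨h1, h2⟩ := hcol (g x) x hx x' hx' rfl hgx.symm hc
    have hδ0 : 0 ≤ δ (r x) := hnet.nonneg hrx
    have htr : ∀ z ∈ T, g z = g x →
        trunc p ((2 ^ 14 * (40 * (R (g x) / s) * √(τ * L))) ^ 2) z ≤ (bI x + 1) * fl := by
      intro z hz hgz
      have hgz' := hgz
      simp only [hg, Prod.mk.injEq] at hgz'
      obtain ⟨f1, f2, f3⟩ := hgz'
      rw [← f3]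
      refine le_trans (trunc_mono p (sq_nonneg _) ?_ z) ((hI z hz).trans (bI_lt z))
      have hτL : 0 ≤ τ * L := by
        have := (Real.log_pos (by norm_num : (1 : ℝ) < 2)).le.trans hL
        positivity
      have hsq : (2 ^ 14 * (40 * (R (g x) / s) * √(τ * L))) ^ 2 =
          (2 ^ 14 * 40) ^ 2 * (R (g x) ^ 2 / s ^ 2) * (τ * L) := by
        rw [mul_pow, mul_pow, mul_pow, div_pow, Real.sq_sqrt hτL]; ring
      rw [hsq]
      refine mul_le_mul_of_nonneg_right (mul_le_mul_of_nonneg_left ?_ (by positivity)) hτL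
      refine div_le_div_of_nonneg_right ?_ (by positivity)
      simp only [hR, hg]
      rw [Real.sq_sqrt (by positivity)]
      refine mul_le_mul_of_nonneg_left ?_ (by positivity)
      rw [← f1, ← f2, hnet.const z hz]
      linarith [bD_le z]
    refine rho_cover p (xb := r x) h2 h1 (?_ : _ ≤ δ (r x)) ?_ (bD_lt x) ?_ (htr x hx rfl)
      (htr x' hx' hgx.symm)
    · rw [hnet.const x hx]
      exact hnet.le x hx _ hrx (hnet.idem x hx).symm
    · change rho p x' (r x) ≤ δ (r x)
      rw [e1, hnet.const x' hx']
      exact hnet.le x' hx' _ (hnet.mem x' hx') (hnet.idem x' hx').symm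
    · simp only [hg]; rw [e2]; exact bD_lt x'
  · exact (min_le_left _ _).trans (hnet.const x hx).le
  · refine (min_le_right _ _).trans ?_
    simp only [hU, hR, hg]
    rw [hnet.const x hx]
    have h1 := bD_le x
    have h2 := bI_le x hx
    have h3 : √(40 * t * (δ x + (bD x + 1) * fl)) ≤
        √(40 * t * (δ x + rho p x (y x) + fl)) :=
      Real.sqrt_le_sqrt (mul_le_mul_of_nonneg_left (by linarith) (by positivity))
    have h4 : √(40 * t * (δ x + (bD x + 1) * fl)) / s * √(τ * l) ≤
        √(40 * t * (δ x + rho p x (y x) + fl)) / s * √(τ * l) := by gcongr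
    linarith
  · have hr'card' : (T.image r').card ≤ (T.image key).card := by convert hr'card
    refine le_trans (Nat.cast_le.2 hr'card') ?_
    have hfib : (T.image key).card ≤
        ⌊2 * exp (s ^ 2 / 2)⌋₊ * ((T.image key).image Prod.fst).card := by
      refine Finset.card_le_mul_card_image _ _ fun k _ => Nat.le_floor ?_
      refine le_trans (Nat.cast_le.2 ?_) (hcard k)
      refine Finset.card_le_card_of_injOn Prod.snd ?_ ?_
      · intro z hz
        obtain ⟨hz1, hz2⟩ := Finset.mem_filter.1 hz
        obtain ⟨x, hx, rfl⟩ := Finset.mem_image.1 hz1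
        refine Finset.mem_image.2 ⟨y x, Finset.mem_image_of_mem y (Finset.mem_filter.2 ⟨hx, hz2⟩), ?_⟩
        simp only [hkey] at hz2 ⊢
        rw [hz2]
      · intro z hz z' hz' e
        exact Prod.ext ((Finset.mem_filter.1 hz).2.trans (Finset.mem_filter.1 hz').2.symm) e
    have hsub : (T.image key).image Prod.fst ⊆ T.image r ×ˢ (Finset.range B ×ˢ Finset.range B) := by
      intro k hk
      obtain ⟨z, hz, rfl⟩ := Finset.mem_image.1 hk
      obtain ⟨x, hx, rfl⟩ := Finset.mem_image.1 hz
      simp only [hkey, hg, Finset.mem_product, Finset.mem_range]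
      refine ⟨Finset.mem_image_of_mem r hx, ?_, ?_⟩
      · refine (Nat.floor_lt (div_nonneg (rho_nonneg _ _ _) hfl.le)).2 ?_
        rw [div_lt_iff₀ hfl]; exact hB x hx
      · refine (Nat.floor_lt (div_nonneg (hI0 x hx) hfl.le)).2 ?_
        rw [div_lt_iff₀ hfl]; exact hB' x hx
    have h2 := Finset.card_le_card hsub
    rw [Finset.card_product, Finset.card_product, Finset.card_range] at h2
    have h3 : ((T.image key).card : ℝ) ≤
        ((⌊2 * exp (s ^ 2 / 2)⌋₊ * ((T.image r).card * (B * B)) : ℕ) : ℝ) :=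
      Nat.cast_le.2 (hfib.trans (Nat.mul_le_mul_left _ h2))
    push_cast at h3
    have h4 : (⌊2 * exp (s ^ 2 / 2)⌋₊ : ℝ) ≤ 2 * exp (s ^ 2 / 2) := Nat.floor_le (by positivity)
    calc _ ≤ _ := h3
      _ ≤ 2 * exp (s ^ 2 / 2) * ((T.image r).card * (B * B)) := by gcongr
      _ = _ := by ring

end Refine

theorem exists_nat_seq {α : Type*} (P : ℕ → α → Prop) (R : ℕ → α → α → Prop) {a₀ : α}
    (h₀ : P 0 a₀) (hstep : ∀ k a, P k a → ∃ b, P (k + 1) b ∧ R k a b) :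
    ∃ f : ℕ → α, f 0 = a₀ ∧ (∀ k, P k (f k)) ∧ ∀ k, R k (f k) (f (k + 1)) := by
  choose! g hg using hstep
  set f : ℕ → α := fun k => Nat.rec a₀ (fun k a => g k a) k with hf
  have hP : ∀ k, P k (f k) := by
    intro k
    induction k with
    | zero => exact h₀
    | succ k ih => exact (hg k _ ih).1
  exact ⟨f, rfl, hP, fun k => (hg k _ (hP k)).2⟩

theorem const_mul_sqrt_mul_le {X Y : ℝ} (hX : 0 ≤ X) (hY : 0 ≤ Y) (c : ℝ) :
    c * √(X * Y) ≤ X / 64 + 16 * c ^ 2 * Y := by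
  rw [Real.sqrt_mul hX]
  nlinarith [sq_nonneg (√X / 8 - 4 * c * √Y), Real.sq_sqrt hX, Real.sq_sqrt hY]

theorem sqrt_term_le {τ l L M s X : ℝ} (hL : 0 < L) (hM : 0 < M)
    (hM2 : M ^ 2 = τ * L * l) (hs : 0 < s) (hX : 0 ≤ X) :
    1280 * (√(40 * (s / M) * X) / s) * √(τ * l) ≤
      X / 64 + 16 * 1280 ^ 2 * (40 * (M / (L * s))) := by
  have h : √(40 * (s / M) * X) / s * √(τ * l) = √(X * (40 * (M / (L * s)))) := by
    rw [← Real.sqrt_sq hs.le, ← Real.sqrt_div' _ (sq_nonneg s), Real.sqrt_sq hs.le,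
      ← Real.sqrt_mul (by positivity)]
    congr 1
    field_simp
    linear_combination -X * hM2
  rw [mul_assoc, h]
  exact const_mul_sqrt_mul_le hX (by positivity) _

theorem trunc_sq {ι E : Type*} [Fintype ι] [AddCommGroup E] [Module ℝ E]
    (p : ι → Seminorm ℝ E) {h : ℝ} (hh : 0 < h) (x : E) :
    trunc p h x ^ 2 = h * ∑ i, p i x ^ 2 * min (p i x ^ 2 / h) (h / p i x ^ 2) := by
  unfold trunc
  rw [l2_sq, Finset.mul_sum]
  refine Finset.sum_congr rfl fun i _ => ?_
  have hp := sq_nonneg (p i x)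
  generalize p i x ^ 2 = a at hp ⊢
  rcases hp.eq_or_lt with e | e
  · rw [← e]; simp [hh.le]
  · rcases le_total a h with h1 | h1
    · rw [min_eq_left h1, min_eq_left (((div_le_one hh).2 h1).trans ((one_le_div e).2 h1))]
      field_simp
    · rw [min_eq_right h1, min_eq_right (((div_le_one e).2 h1).trans ((one_le_div hh).2 h1))]
      field_simp

theorem trunc_term_le {τ l L M s X ω α I : ℝ} (hl : 0 < l) (hM : 0 < M)
    (hM2 : M ^ 2 = τ * L * l) (hs : 0 < s) (hX : 0 ≤ X) (hα : 0 ≤ α) (hω : 0 ≤ ω) (hI : 0 ≤ I)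
    (hI2 : I ^ 2 = α * (40 * (s / M) * X / s ^ 2) * (τ * L) * ω) :
    256 * I ≤ X / 64 + 16 * 256 ^ 2 * (40 * α * (M / (l * s)) * ω) := by
  have h : I = √(X * (40 * α * (M / (l * s)) * ω)) := by
    rw [← Real.sqrt_sq hI, hI2]
    congr 1
    field_simp
    linear_combination -(α * X * ω) * hM2
  rw [h]
  exact const_mul_sqrt_mul_le hX (by positivity) _

theorem level_bound {τ l L M s δ' δ D ω α I : ℝ} (hl : 0 < l) (hL : 0 < L)
    (hM : 0 < M) (hM2 : M ^ 2 = τ * L * l) (hs : 0 < s) (hδ : 0 ≤ δ) (hD : 0 ≤ D) (hα : 0 ≤ α)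
    (hω : 0 ≤ ω) (hI : 0 ≤ I)
    (hI2 : I ^ 2 = α * (40 * (s / M) * (δ + D + M / (L * s)) / s ^ 2) * (τ * L) * ω)
    (hδ' : δ' ≤ 148 * (D + M / (L * s)) +
      1280 * (√(40 * (s / M) * (δ + D + M / (L * s))) / s) * √(τ * l) +
      (δ + D + M / (L * s)) / 64 + 256 * (I + M / (L * s))) :
    2 * s * δ' ≤ 3 / 32 * (s * δ) + 298 * (s * D) +
      (32 * 1280 ^ 2 * 40 + 810) * (M / L) + 32 * 256 ^ 2 * 40 * α * (M / l) * ω := by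
  have hX : 0 ≤ δ + D + M / (L * s) := by positivity
  have h1 := sqrt_term_le hL hM hM2 hs hX
  have h2 := trunc_term_le hl hM hM2 hs hX hα hω hI hI2
  have e1 : s * (M / (L * s)) = M / L := by field_simp
  have e2 : s * (M / (l * s)) = M / l := by field_simp
  have h3 : δ' ≤ 3 / 64 * δ + 149 * D + (16 * 1280 ^ 2 * 40 + 405) * (M / (L * s)) +
      16 * 256 ^ 2 * (40 * α * (M / (l * s)) * ω) := by
    have : 0 ≤ M / (L * s) := by positivity
    linarith
  have h4 := mul_le_mul_of_nonneg_left h3 (by positivity : 0 ≤ 2 * s)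
  calc _ ≤ _ := h4
    _ = 3 / 32 * (s * δ) + 298 * (s * D) + (32 * 1280 ^ 2 * 40 + 810) * (s * (M / (L * s))) +
      32 * 256 ^ 2 * 40 * α * (s * (M / (l * s))) * ω := by ring
    _ = _ := by rw [e1, e2]

theorem sum_le_of_level_bound (a D ω : ℕ → ℝ) {c A₀ A₁ A₂ : ℝ} (ha : ∀ k, 0 ≤ a k)
    (hc : 0 ≤ c) (hA : 0 ≤ A₀) (N : ℕ)
    (h : ∀ k, a (k + 1) ≤ 3 / 32 * a k + 298 * D k + A₁ + c * ω k)
    (h0 : a 0 ≤ A₀) (hD : ∑ k ∈ Finset.range N, D k ≤ A₂) (hω : ∑ k ∈ Finset.range N, ω k ≤ 5)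
    (hA1 : 0 ≤ A₁ * N) (hA2 : 0 ≤ A₂) :
    ∑ k ∈ Finset.range (N + 1), a k ≤ 2 * (A₀ + 298 * A₂ + A₁ * N + 5 * c) := by
  have h1 : ∑ k ∈ Finset.range N, a (k + 1) ≤ 3 / 32 * ∑ k ∈ Finset.range N, a k +
      298 * ∑ k ∈ Finset.range N, D k + A₁ * N + c * ∑ k ∈ Finset.range N, ω k := by
    refine (Finset.sum_le_sum fun k _ => h k).trans (le_of_eq ?_)
    simp only [Finset.sum_add_distrib, Finset.mul_sum, Finset.sum_const, Finset.card_range,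
      nsmul_eq_mul]
    ring
  have h2 := Finset.sum_range_succ' a N
  have h3 := Finset.sum_range_succ a N
  have h4 := ha N
  have h5 := mul_le_mul_of_nonneg_left hω hc
  have h6 : 0 ≤ ∑ k ∈ Finset.range (N + 1), a k := Finset.sum_nonneg fun k _ => ha k
  linarith

theorem nat_floor_sq_mul_le {s L : ℝ} (hL : log 2 ≤ L) (hs : L ≤ s ^ 2) :
    ((⌊2 * s ^ 2⌋₊ + 1 : ℕ) : ℝ) ^ 2 * (2 * exp (s ^ 2 / 2)) ≤ exp (6 * s ^ 2) := by
  have h1 : ((⌊2 * s ^ 2⌋₊ + 1 : ℕ) : ℝ) ≤ exp (2 * s ^ 2) := by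
    have := Nat.floor_le (by positivity : 0 ≤ 2 * s ^ 2)
    have := Real.add_one_le_exp (2 * s ^ 2)
    push_cast; linarith
  have h2 : (2 : ℝ) ≤ exp (s ^ 2) := by
    rw [← Real.log_le_iff_le_exp (by norm_num)]; exact hL.trans hs
  calc _ ≤ exp (2 * s ^ 2) ^ 2 * (exp (s ^ 2) * exp (s ^ 2 / 2)) := by gcongr
    _ = exp (5.5 * s ^ 2) := by
      rw [← Real.exp_nat_mul, ← Real.exp_add, ← Real.exp_add]; congr 1; push_cast; ring
    _ ≤ _ := Real.exp_le_exp.2 (by nlinarith [sq_nonneg s])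

/-- The absolute constant in the chaining estimate. -/
noncomputable def chainConst : ℝ :=
  2 * (24 + 298 * 4 + (32 * 1280 ^ 2 * 40 + 810) * 4 +
    5 * (32 * 256 ^ 2 * 40 * (2 ^ 14 * 40) ^ 2 * 2))

section NetSequence
variable {E : Type*} [NormedAddCommGroup E] [InnerProductSpace ℝ E]

theorem sq_le_of_eq_abs_inner {ι κ : Type*} (p : ι → Seminorm ℝ E)
    (S : ι → Finset κ) (b : ι → κ → E)
    (hp : ∀ i x, p i x = 0 ∨ ∃ j ∈ S i, p i x = |inner ℝ (b i j) x|) {τ : ℝ} (hτ : 0 < τ)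
    (hb : ∀ i, ∀ j ∈ S i, ‖b i j‖ ^ 2 ≤ τ) {x : E} (hx : ‖x‖ ^ 2 ≤ 2) (i : ι) :
    p i x ^ 2 ≤ 2 * τ := by
  rcases hp i x with h | ⟨j, hj, h⟩
  · rw [h, zero_pow two_ne_zero]; positivity
  · rw [h]
    calc _ ≤ (‖b i j‖ * ‖x‖) ^ 2 := by
          exact pow_le_pow_left₀ (abs_nonneg _) (abs_real_inner_le_norm _ _) 2
      _ = ‖b i j‖ ^ 2 * ‖x‖ ^ 2 := mul_pow _ _ _
      _ ≤ τ * 2 := mul_le_mul (hb i j hj) hx (sq_nonneg _) hτ.le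
      _ = _ := mul_comm _ _

theorem l2_sq_le_sqrt {ι : Type*} [Fintype ι] {a : ι → ℝ} (ha : ∀ i, 0 ≤ a i) {c : ℝ}
    (hc : ∀ i, a i ≤ c) (hsum : ∑ i, a i ≤ 1) : l2 a ≤ √c := by
  rcases isEmpty_or_nonempty ι with h | ⟨⟨i⟩⟩
  · simp [l2]
  have hc0 : 0 ≤ c := (ha i).trans (hc i)
  refine Real.sqrt_le_sqrt ?_
  calc _ ≤ ∑ i, c * a i := Finset.sum_le_sum fun i _ => by
        rw [sq]; exact mul_le_mul_of_nonneg_right (hc i) (ha i)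
    _ = c * ∑ i, a i := (Finset.mul_sum _ _ _).symm
    _ ≤ c := mul_le_of_le_one_right hc0 hsum

variable [FiniteDimensional ℝ E] [MeasurableSpace E] [BorelSpace E]

theorem exists_net_sequence {ι κ : Type*} [Fintype ι] (p : ι → Seminorm ℝ E)
    (S : ι → Finset κ) (b : ι → κ → E)
    (hp : ∀ i x, p i x = 0 ∨ ∃ j ∈ S i, p i x = |inner ℝ (b i j) x|) {τ l L : ℝ} (hτ : 0 < τ)
    (hb : ∀ i, ∀ j ∈ S i, ‖b i j‖ ^ 2 ≤ τ) (hl : log 2 ≤ l) (hL : log 2 ≤ L)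
    (hS : ∀ i, ((S i).card : ℝ) ≤ exp l) (hT : (∑ i, (S i).card : ℝ) ≤ exp L)
    (T : Finset E) (hT0 : 0 ∈ T) (hT2 : ∀ x ∈ T, ‖x‖ ^ 2 ≤ 2)
    (hT1 : ∀ x ∈ T, ∑ i, p i x ^ 2 ≤ 1) :
    ∃ (r : ℕ → E → E) (δ : ℕ → E → ℝ), (∀ k, IsNet p T (r k) (δ k)) ∧ (∀ x, r 0 x = 0) ∧
      (∀ k, ∀ x ∈ T, r k (r (k + 1) x) = r k x) ∧
      (∀ k, ((T.image (r k)).card : ℝ) ≤ exp (2 * (√L * 2 ^ k) ^ 2)) ∧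
      ∀ x ∈ T, ∀ N : ℕ, N ≤ 4 * L →
        ∑ k ∈ Finset.range (N + 1), √L * 2 ^ k * δ k x ≤ chainConst * √(τ * L * l) := by
  have hlog : (1 / 2 : ℝ) < log 2 := by linarith [Real.log_two_gt_d9]
  have hl0 : 0 < l := by linarith
  have hL0 : 0 < L := by linarith
  set M := √(τ * L * l) with hM
  have hM0 : 0 < M := by positivity
  have hM2 : M ^ 2 = τ * L * l := Real.sq_sqrt (by positivity)
  set s : ℕ → ℝ := fun k => √L * 2 ^ k with hs
  have hs0 : ∀ k, 0 < s k := fun k => by positivity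
  have hs1 : ∀ k, s (k + 1) = 2 * s k := fun k => by simp only [hs]; ring
  have hsL : ∀ k, L ≤ s k ^ 2 := fun k => by
    simp only [hs]
    rw [mul_pow, Real.sq_sqrt hL0.le]
    exact le_mul_of_one_le_right hL0.le (one_le_pow₀ (one_le_pow₀ (by norm_num)))
  obtain ⟨y, hy⟩ := exists_interpolants p (t₀ := √L / M) (by positivity)
  have hst : ∀ k, √L / M * 2 ^ k = s k / M := fun k => by simp only [hs]; ring
  simp only [hst] at hy
  set D : ℕ → E → ℝ := fun k x => rho p x (y k x) with hD
  set fl : ℕ → ℝ := fun k => M / (L * s k) with hfl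
  have hfl0 : ∀ k, 0 < fl k := fun k => by have := hs0 k; positivity
  set α : ℝ := (2 ^ 14 * 40) ^ 2 with hα
  set h : ℕ → ℝ → E → ℝ := fun k d x =>
    α * (40 * (s k / M) * (d + D k x + fl k) / s k ^ 2) * (τ * L) with hh
  have hl2 : ∀ x ∈ T, l2 (fun i => p i x ^ 2) ≤ √(2 * τ) := fun x hx =>
    l2_sq_le_sqrt (fun i => sq_nonneg _)
      (fun i => sq_le_of_eq_abs_inner p S b hp hτ hb (hT2 x hx) i) (hT1 x hx)
  have hBlt : ∀ k (u : ℝ), u ≤ 2 * M * s k / L →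
      u < ((⌊2 * s k ^ 2⌋₊ + 1 : ℕ) : ℝ) * fl k := by
    intro k u hu
    have h1 := mul_lt_mul_of_pos_right (Nat.lt_floor_add_one (2 * s k ^ 2)) (hfl0 k)
    have h2 : 2 * s k ^ 2 * fl k = 2 * M * s k / L := by
      have := (hs0 k).ne'
      simp only [hfl]; field_simp
    push_cast
    linarith
  have hsL' : ∀ k, √L ≤ s k := fun k => Real.sqrt_le_iff.2 ⟨(hs0 k).le, hsL k⟩
  have hτM : ∀ k, √(2 * τ) ≤ 2 * M * s k / L := by
    intro k
    have h1 : √(2 * τ) ≤ 2 * M * √L / L := by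
      refine Real.sqrt_le_iff.2 ⟨by positivity, ?_⟩
      rw [div_pow, mul_pow, mul_pow, Real.sq_sqrt hL0.le, hM2, le_div_iff₀ (by positivity)]
      have : 0 ≤ τ * L ^ 2 * (4 * l - 2) := by
        have : 0 ≤ 4 * l - 2 := by linarith
        positivity
      linarith
    refine h1.trans ?_
    have := hsL' k
    gcongr
  have hDM : ∀ k, ∀ x ∈ T, D k x ≤ 2 * M * s k / L := by
    intro k x hx
    have h1 := (hy x (hT2 x hx)).1 k
    have h2 := hs0 k
    rw [div_mul_eq_mul_div, div_le_iff₀ hM0] at h1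
    rw [le_div_iff₀ hL0]
    have h3 : 0 ≤ D k x := rho_nonneg _ _ _
    have h4 : D k x * L ≤ D k x * s k ^ 2 := mul_le_mul_of_nonneg_left (hsL k) h3
    have h5 : s k * D k x * s k ≤ 2 * M * s k := mul_le_mul_of_nonneg_right h1 h2.le
    linarith
  have htl2 : ∀ x ∈ T, ∀ h, 0 ≤ h → trunc p h x ≤ √(2 * τ) := fun x hx h hh0 =>
    le_trans (l2_mono (g := fun i => p i x ^ 2) fun i => by
      rw [abs_of_nonneg (le_min (sq_nonneg _) hh0)]; exact min_le_left _ _) (hl2 x hx)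
  have hrho0 : ∀ x ∈ T, rho p x 0 ≤ √(2 * τ) := fun x hx => by
    refine le_of_eq_of_le ?_ (hl2 x hx)
    simp [rho, qdist, sq]
  have hD0 : ∀ k x, 0 ≤ D k x := fun k x => rho_nonneg _ _ _
  have hhpos : ∀ k d x, 0 ≤ d → 0 < h k d x := fun k d x hd => by
    have := hs0 k; have := hfl0 k; have := hD0 k x
    simp only [hh]
    positivity
  obtain ⟨f, hf0, hfP, hfR⟩ := exists_nat_seq
    (fun k (a : (E → E) × (E → ℝ)) => IsNet p T a.1 a.2 ∧
      ((T.image a.1).card : ℝ) ≤ exp (2 * s k ^ 2))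
    (fun k a a' => (∀ x ∈ T, a.1 (a'.1 x) = a.1 x) ∧ (∀ x ∈ T, a'.2 x ≤ a.2 x) ∧
      ∀ x ∈ T, a'.2 x ≤ 148 * (D k x + fl k) +
        1280 * (√(40 * (s k / M) * (a.2 x + D k x + fl k)) / s k) * √(τ * l) +
        (a.2 x + D k x + fl k) / 64 + 256 * (trunc p (h k (a.2 x) x) x + fl k))
    (a₀ := (fun _ => 0, fun _ => 12 * √τ)) ⟨⟨fun _ _ => hT0, fun _ _ => rfl, fun _ _ => rfl,
      fun x hx x' hx' _ => by
        have h1 := rho_triangle p x 0 x'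
        have h2 := hrho0 x hx
        have h3 := hrho0 x' hx'
        rw [rho_comm] at h3
        have h4 : √(2 * τ) ≤ 3 / 2 * √τ := Real.sqrt_le_iff.2 ⟨by positivity, by
          rw [mul_pow, Real.sq_sqrt hτ.le]; linarith⟩
        change _ ≤ 12 * √τ
        linarith⟩, by
        refine le_trans ?_ (Real.one_le_exp (by positivity))
        exact_mod_cast Finset.card_le_one.2 fun a ha b hb => by
          obtain ⟨_, -, rfl⟩ := Finset.mem_image.1 ha
          obtain ⟨_, -, rfl⟩ := Finset.mem_image.1 hb
          rfl⟩
    (by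
      rintro k ⟨r, δ⟩ ⟨hnet, hcard⟩
      obtain ⟨r', δ', h1, h2, h3, h4, h5⟩ := exists_refinement p S b hp hτ hb hl hL hS hT T hT1
        (t := s k / M) (div_pos (hs0 k) hM0) (hs0 k) (hfl0 k) (y k)
        (fun x hx x' hx' Δ D' e1 e2 e3 => (hy x (hT2 x hx)).2.2.2 x' (hT2 x' hx') k Δ D' e1 e2 e3)
        r δ hnet (fun x => trunc p (h k (δ x) x) x) (fun x _ => l2_nonneg _) (fun x _ => le_rfl)
        (⌊2 * s k ^ 2⌋₊ + 1) (fun x hx => hBlt k _ (hDM k x hx))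
        (fun x hx => hBlt k _ ((htl2 x hx _ (hhpos k _ x (hnet.nonneg hx)).le).trans (hτM k)))
      refine ⟨(r', δ'), ⟨h1, h5.trans ?_⟩, h2, h3, h4⟩
      calc _ = ((T.image r).card : ℝ) *
            (((⌊2 * s k ^ 2⌋₊ + 1 : ℕ) : ℝ) ^ 2 * (2 * exp (s k ^ 2 / 2))) := mul_assoc _ _ _
        _ ≤ exp (2 * s k ^ 2) * exp (6 * s k ^ 2) :=
          mul_le_mul hcard (nat_floor_sq_mul_le hL (hsL k)) (by positivity) (exp_pos _).le
        _ = _ := by rw [← Real.exp_add, hs1]; congr 1; ring)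
  refine ⟨fun k => (f k).1, fun k => (f k).2, fun k => (hfP k).1, fun x => by simp only [hf0],
    fun k => (hfR k).1, fun k => (hfP k).2, ?_⟩
  intro x hx N hN
  set d : ℕ → ℝ := fun k => (f k).2 x with hd
  have hd0 : ∀ k, 0 ≤ d k := fun k => (hfP k).1.nonneg hx
  set H : ℕ → ℝ := fun k => h k (d k) x with hH
  set ω : ℕ → ℝ := fun k => ∑ i, p i x ^ 2 * min (p i x ^ 2 / H k) (H k / p i x ^ 2) with hω
  obtain ⟨-, hanti, hDsum, -⟩ := hy x (hT2 x hx)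
  have hHpos : ∀ k, 0 < H k := fun k => hhpos k _ x (hd0 k)
  have hω0 : ∀ k, 0 ≤ ω k := fun k => Finset.sum_nonneg fun i _ =>
    mul_nonneg (sq_nonneg _) (le_min (div_nonneg (sq_nonneg _) (hHpos k).le)
      (div_nonneg (hHpos k).le (sq_nonneg _)))
  have hHhalf : ∀ k, H (k + 1) ≤ H k / 2 := by
    intro k
    have e : ∀ k d, h k d x = α * 40 * (τ * L) / M * ((d + D k x + fl k) / s k) := by
      intro k d
      have := (hs0 k).ne'
      simp only [hh]
      field_simp
    simp only [hH]
    rw [e, e, mul_div_assoc (α * 40 * (τ * L) / M), hs1, div_div (d k + D k x + fl k),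
      mul_comm (s k) 2]
    have h1 := (hfR k).2.1 x hx
    have h2 := hanti k
    have h3 : fl (k + 1) ≤ fl k := by
      have := hs0 k
      simp only [hfl, hs1]
      gcongr
      linarith
    have := hs0 k
    have h4 : d (k + 1) + D (k + 1) x + fl (k + 1) ≤ d k + D k x + fl k :=
      add_le_add (add_le_add h1 h2) h3
    gcongr
  have hωsum : ∑ k ∈ Finset.range N, ω k ≤ 5 := by
    simp only [hω]
    rw [Finset.sum_comm]
    simp only [← Finset.mul_sum]
    calc _ ≤ ∑ i, p i x ^ 2 * 5 := Finset.sum_le_sum fun i _ =>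
          mul_le_mul_of_nonneg_left (sum_min_div_le H hHpos hHhalf (sq_nonneg _) N) (sq_nonneg _)
      _ = (∑ i, p i x ^ 2) * 5 := (Finset.sum_mul _ _ _).symm
      _ ≤ 5 := by linarith [hT1 x hx]
  have hlev : ∀ k, s (k + 1) * d (k + 1) ≤ 3 / 32 * (s k * d k) + 298 * (s k * D k x) +
      (32 * 1280 ^ 2 * 40 + 810) * (M / L) + 32 * 256 ^ 2 * 40 * α * (M / l) * ω k := by
    intro k
    rw [hs1]
    exact level_bound hl0 hL0 hM0 hM2 (hs0 k) (hd0 k) (hD0 k x) (by positivity) (hω0 k)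
      (l2_nonneg _) (trunc_sq p (hHpos k) x) ((hfR k).2.2 x hx)
  have hDs : ∑ k ∈ Finset.range N, s k * D k x ≤ 4 * M := by
    have := hDsum N
    simp only [div_mul_eq_mul_div] at this
    rwa [← Finset.sum_div, div_le_iff₀ hM0] at this
  have hl2' : M / l ≤ 2 * M := by
    rw [div_le_iff₀ hl0]; nlinarith
  have hN' : M / L * N ≤ 4 * M := by
    rw [div_mul_eq_mul_div, div_le_iff₀ hL0]; nlinarith
  have h00 : s 0 * d 0 ≤ 24 * M := by
    simp only [hs, hd, hf0, pow_zero, mul_one]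
    have h1 : √L * √τ ≤ 2 * M := by
      rw [← Real.sqrt_mul hL0.le]
      refine Real.sqrt_le_iff.2 ⟨by positivity, ?_⟩
      rw [mul_pow, hM2]
      have : 0 ≤ τ * L * (4 * l - 1) := by
        have : 0 ≤ 4 * l - 1 := by linarith
        positivity
      linarith
    linarith
  have := sum_le_of_level_bound (fun k => s k * d k) (fun k => s k * D k x) ω
    (fun k => mul_nonneg (hs0 k).le (hd0 k)) (by positivity) (by positivity) N hlev h00 hDs hωsum
    (by positivity) (by positivity)
  refine this.trans ?_
  unfold chainConst
  simp only [hα]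
  linarith
end NetSequence

theorem abs_sum_le_sqrt_card_mul_l2 {ι : Type*} [Fintype ι] {σ : ι → ℝ}
    (hσ : ∀ i, σ i = 1 ∨ σ i = -1) (c : ι → ℝ) :
    |∑ i, σ i * c i| ≤ √(Fintype.card ι) * l2 c := by
  rw [l2, ← Real.sqrt_mul (Nat.cast_nonneg _)]
  refine Real.abs_le_sqrt ?_
  have h := sq_sum_le_card_mul_sum_sq (s := Finset.univ) (f := fun i => σ i * c i)
  refine h.trans (le_of_eq ?_)
  rw [Finset.card_univ]
  congr 1
  refine Finset.sum_congr rfl fun i _ => ?_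
  rcases hσ i with e | e <;> rw [e] <;> ring

theorem sum_two_mul_exp_le {L : ℝ} (hL : log 2 ≤ L) (N : ℕ) :
    ∑ k ∈ Finset.range N, exp (2 * (√L * 2 ^ (k + 1)) ^ 2) *
      (2 * exp (-(5 * (√L * 2 ^ k)) ^ 2 / 2)) ≤ 1 := by
  have hL0 : 0 ≤ L := (Real.log_nonneg (by norm_num)).trans hL
  have h1 : ∀ k : ℕ, exp (2 * (√L * 2 ^ (k + 1)) ^ 2) *
      (2 * exp (-(5 * (√L * 2 ^ k)) ^ 2 / 2)) ≤ (1 / 2) ^ k / 2 := by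
    intro k
    have e2 : (2 : ℝ) = exp (log 2) := (Real.exp_log (by norm_num)).symm
    have hk : (k : ℝ) + 1 ≤ 4 ^ k := by
      have := one_add_mul_le_pow (a := (3 : ℝ)) (by norm_num) k
      norm_num at this
      have : (0 : ℝ) ≤ k := Nat.cast_nonneg k
      linarith
    have e3 : ((1 : ℝ) / 2) ^ k / 2 = exp (-((k + 1) * log 2)) := by
      rw [← mul_neg, ← Nat.cast_succ, Real.exp_nat_mul, Real.exp_neg, Real.exp_log (by norm_num),
        pow_succ]
      norm_num
      ring
    rw [e3]
    have e6 : 2 * exp (-(5 * (√L * 2 ^ k)) ^ 2 / 2) =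
        exp (log 2) * exp (-(5 * (√L * 2 ^ k)) ^ 2 / 2) := by rw [← e2]
    rw [e6, ← Real.exp_add, ← Real.exp_add]
    refine Real.exp_le_exp.2 ?_
    have e4 : ((2 : ℝ) ^ k) ^ 2 = 4 ^ k := by rw [← pow_mul, mul_comm, pow_mul]; norm_num
    have e5 : 2 * (√L * 2 ^ (k + 1)) ^ 2 + (log 2 + -(5 * (√L * 2 ^ k)) ^ 2 / 2) =
        log 2 - 9 / 2 * (L * 4 ^ k) := by
      rw [pow_succ 2 k, mul_pow, mul_pow, mul_pow, mul_pow, Real.sq_sqrt hL0, e4]; ring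
    rw [e5]
    have h0 : 0 < log 2 := Real.log_pos (by norm_num)
    have h2 : log 2 * ((k : ℝ) + 1) ≤ L * 4 ^ k := mul_le_mul hL hk (by positivity) hL0
    have h3 : log 2 * 1 ≤ log 2 * ((k : ℝ) + 1) :=
      mul_le_mul_of_nonneg_left (by simp) h0.le
    linarith
  refine (Finset.sum_le_sum fun k _ => h1 k).trans ?_
  rw [← Finset.sum_div]
  have := (summable_geometric_of_lt_one (by norm_num) (by norm_num : (1 / 2 : ℝ) < 1)).sum_le_tsum
    (Finset.range N) (fun _ _ => by positivity)
  rw [tsum_geometric_two] at this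
  linarith

section Core
variable {E : Type*} [NormedAddCommGroup E] [InnerProductSpace ℝ E]
  [FiniteDimensional ℝ E] [MeasurableSpace E] [BorelSpace E]

theorem exists_signs_of_groups {ι κ : Type*} [Fintype ι] (p : ι → Seminorm ℝ E)
    (S : ι → Finset κ) (b : ι → κ → E)
    (hp : ∀ i x, p i x = 0 ∨ ∃ j ∈ S i, p i x = |inner ℝ (b i j) x|) {τ l L : ℝ} (hτ : 0 < τ)
    (hb : ∀ i, ∀ j ∈ S i, ‖b i j‖ ^ 2 ≤ τ) (hl : log 2 ≤ l) (hL : log 2 ≤ L)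
    (hι : (Fintype.card ι : ℝ) ≤ exp L)
    (hS : ∀ i, ((S i).card : ℝ) ≤ exp l) (hT : (∑ i, (S i).card : ℝ) ≤ exp L)
    (T : Finset E) (hT0 : 0 ∈ T) (hT2 : ∀ x ∈ T, ‖x‖ ^ 2 ≤ 2)
    (hT1 : ∀ x ∈ T, ∑ i, p i x ^ 2 ≤ 1) :
    ∃ σ : ι → ℝ, (∀ i, σ i = 1 ∨ σ i = -1) ∧
      ∀ x ∈ T, |∑ i, σ i * p i x ^ 2| ≤ 10 * chainConst * √(τ * L * l) := by
  obtain ⟨r, δ, hnet, hr0, hrr, hcard, hsum⟩ :=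
    exists_net_sequence p S b hp hτ hb hl hL hS hT T hT0 hT2 hT1
  have hlog : (1 / 2 : ℝ) < log 2 := by linarith [Real.log_two_gt_d9]
  have hL0 : 0 < L := by linarith
  set s : ℕ → ℝ := fun k => √L * 2 ^ k with hs
  have hs0 : ∀ k, 0 < s k := fun k => by positivity
  set N := ⌈2 * L⌉₊ with hN
  obtain ⟨σ, hσ, hlink⟩ := exists_signs
    ((Finset.range N).sigma fun k => T.image (r (k + 1)))
    (fun z i => p i (r z.1 z.2) ^ 2 - p i z.2 ^ 2) (fun z => 5 * s z.1)
    (fun z _ => by have := hs0 z.1; positivity) (by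
      rw [Finset.sum_sigma]
      refine le_trans (Finset.sum_le_sum fun k _ => ?_) (sum_two_mul_exp_le hL N)
      dsimp only
      rw [Finset.sum_const, nsmul_eq_mul]
      exact mul_le_mul_of_nonneg_right (hcard (k + 1)) (by positivity))
  refine ⟨σ, hσ, fun x hx => ?_⟩
  set X : E → ℝ := fun z => ∑ i, σ i * p i z ^ 2 with hX
  have hXsub : ∀ z w, X z - X w = ∑ i, σ i * (p i z ^ 2 - p i w ^ 2) := fun z w => by
    simp only [hX, mul_sub, Finset.sum_sub_distrib]
  have hstep : ∀ k ∈ Finset.range N, |X (r (k + 1) x) - X (r k x)| ≤ 10 * (s k * δ k x) := by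
    intro k hk
    have hz : r (k + 1) x ∈ T := (hnet (k + 1)).mem x hx
    have h1 := hlink ⟨k, r (k + 1) x⟩ (Finset.mem_sigma.2 ⟨hk, Finset.mem_image_of_mem _ hx⟩)
    have h2 := (l2_sq_sub_sq_le_rho p (r k (r (k + 1) x)) (r (k + 1) x)).trans
      (mul_le_mul_of_nonneg_left ((hnet k).le _ ((hnet k).mem _ hz) _ hz ((hnet k).idem _ hz))
        zero_le_two)
    rw [(hnet k).const _ hz, ← (hnet k).const _ hz, hrr k x hx, (hnet k).const _ hx] at h2
    simp only [hrr k x hx] at h1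
    rw [abs_sub_comm, hXsub]
    have h3 := mul_le_mul_of_nonneg_left h2 (by have := hs0 k; positivity : 0 ≤ 5 * s k)
    calc _ ≤ _ := h1
      _ ≤ _ := h3
      _ = _ := by ring
  have hlast : |X x - X (r N x)| ≤ 10 * (s N * δ N x) := by
    have hδ := (hnet N).nonneg hx
    have h1 := abs_sum_le_sqrt_card_mul_l2 hσ (fun i => p i x ^ 2 - p i (r N x) ^ 2)
    have h2 := (l2_sq_sub_sq_le_rho p x (r N x)).trans
      (mul_le_mul_of_nonneg_left ((hnet N).le x hx _ ((hnet N).mem _ hx) ((hnet N).idem x hx).symm)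
        zero_le_two)
    have h3 : √(Fintype.card ι) ≤ s N := by
      refine Real.sqrt_le_iff.2 ⟨(hs0 N).le, hι.trans ?_⟩
      have e1 : s N ^ 2 = L * 4 ^ N := by
        simp only [hs]
        rw [mul_pow, Real.sq_sqrt hL0.le, ← pow_mul, mul_comm N 2, pow_mul]
        norm_num
      have e2 : exp (2 * L) ≤ 4 ^ N := by
        have h4 : (4 : ℝ) = exp (2 * log 2) := by
          rw [two_mul, Real.exp_add, Real.exp_log (by norm_num)]; norm_num
        rw [h4, ← Real.exp_nat_mul]
        refine Real.exp_le_exp.2 ?_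
        have := Nat.le_ceil (2 * L)
        nlinarith
      have e3 : 2 ≤ exp L := (Real.log_le_iff_le_exp (by norm_num)).1 hL
      rw [e1]
      calc exp L ≤ L * (exp L * exp L) := by nlinarith
        _ = L * exp (2 * L) := by rw [two_mul, Real.exp_add]
        _ ≤ _ := mul_le_mul_of_nonneg_left e2 hL0.le
    rw [hXsub]
    calc _ ≤ _ := h1
      _ ≤ s N * (2 * δ N x) := mul_le_mul h3 h2 (l2_nonneg _) (hs0 N).le
      _ ≤ _ := by have := mul_nonneg (hs0 N).le hδ; linarith
  have hX0 : X (r 0 x) = 0 := by simp [hX, hr0]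
  have htel := Finset.sum_range_sub (fun k => X (r k x)) N
  have h1 : |X (r N x)| ≤ ∑ k ∈ Finset.range N, 10 * (s k * δ k x) := by
    rw [← sub_zero (X (r N x)), ← hX0, ← htel]
    exact (Finset.abs_sum_le_sum_abs _ _).trans (Finset.sum_le_sum hstep)
  have h2 := hsum x hx N (by
    have := Nat.ceil_lt_add_one (by positivity : 0 ≤ 2 * L)
    linarith)
  rw [Finset.sum_range_succ] at h2
  rw [← Finset.mul_sum] at h1
  have h3 : |X x| ≤ |X x - X (r N x)| + |X (r N x)| := by
    simpa using abs_add_le (X x - X (r N x)) (X (r N x))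
  linarith

end Core

theorem trace_nonpos_of_det_one_add_smul_le {n : ℕ} (K : Matrix (Fin n) (Fin n) ℝ)
    (h : ∀ t : ℝ, 0 < t → t ≤ 1 → det (1 + t • K) ≤ 1) : trace K ≤ 0 := by
  set q := (det (1 + (Polynomial.X : Polynomial ℝ) • K.map Polynomial.C)).divX.divX with hq
  have hc : Continuous fun t : ℝ => trace K + q.eval t * t := by fun_prop
  have h0 : Filter.Tendsto (fun t : ℝ => trace K + q.eval t * t) (nhdsWithin 0 (Set.Ioi 0))
      (nhds (trace K)) := by
    have := hc.tendsto 0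
    simp only [mul_zero, add_zero] at this
    exact this.mono_left nhdsWithin_le_nhds
  refine le_of_tendsto h0 ?_
  filter_upwards [Ioc_mem_nhdsGT (zero_lt_one' ℝ)] with t ht
  have h1 := h t ht.1 ht.2
  rw [det_one_add_smul, ← hq] at h1
  have : (trace K + q.eval t * t) * t ≤ 0 * t := by linarith
  exact le_of_mul_le_mul_right this ht.1

theorem trace_inv_mul_le_of_isMaxOn {n : ℕ} {M N : Matrix (Fin n) (Fin n) ℝ} (hM : M.PosDef)
    (h : ∀ t : ℝ, 0 < t → t ≤ 1 → det (M + t • N) ≤ det M) : trace (M⁻¹ * N) ≤ 0 := by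
  refine trace_nonpos_of_det_one_add_smul_le _ fun t ht ht1 => ?_
  have hu : IsUnit M.det := isUnit_iff_ne_zero.2 hM.det_pos.ne'
  have e : M + t • N = M * (1 + t • (M⁻¹ * N)) := by
    rw [mul_add, mul_one, Matrix.mul_smul, ← Matrix.mul_assoc, Matrix.mul_nonsing_inv _ hu,
      Matrix.one_mul]
  have h1 := h t ht ht1
  rw [e, det_mul] at h1
  exact le_of_mul_le_mul_left (by linarith) hM.det_pos

/-- The weights that assign to every group a probability vector on that group. -/
def groupSimplex {ι κ : Type*} (S : ι → Finset κ) : Set (ι → κ → ℝ) :=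
  {w | (∀ i j, 0 ≤ w i j) ∧ (∀ i, ∀ j ∉ S i, w i j = 0) ∧ ∀ i, ∑ j ∈ S i, w i j = 1}

theorem isCompact_groupSimplex {ι κ : Type*} (S : ι → Finset κ) :
    IsCompact (groupSimplex S) := by
  have hsub : groupSimplex S ⊆ Set.Icc 0 1 := by
    rintro w ⟨h1, h2, h3⟩
    refine ⟨fun i j => h1 i j, fun i j => ?_⟩
    by_cases hj : j ∈ S i
    · exact (Finset.single_le_sum (fun j _ => h1 i j) hj).trans (h3 i).le
    · rw [h2 i j hj]; exact zero_le_one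
  refine IsCompact.of_isClosed_subset isCompact_Icc ?_ hsub
  have e : groupSimplex S = (⋂ i, ⋂ j, {w | 0 ≤ w i j}) ∩
      ((⋂ i, ⋂ j, ⋂ (_ : j ∉ S i), {w | w i j = 0}) ∩ ⋂ i, {w | ∑ j ∈ S i, w i j = 1}) := by
    ext w; simp [groupSimplex]
  rw [e]
  refine (isClosed_iInter fun i => isClosed_iInter fun j => ?_).inter
    ((isClosed_iInter fun i => isClosed_iInter fun j => isClosed_iInter fun _ => ?_).inter
      (isClosed_iInter fun i => ?_))
  · exact isClosed_le (by fun_prop) (by fun_prop)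
  · exact isClosed_eq (by fun_prop) (by fun_prop)
  · exact isClosed_eq (by fun_prop) (by fun_prop)

theorem update_mem_groupSimplex {ι κ : Type*} {S : ι → Finset κ} {w : ι → κ → ℝ}
    (hw : w ∈ groupSimplex S) {i : ι} {j : κ} (hj : j ∈ S i) {t : ℝ} (ht : 0 ≤ t) (ht1 : t ≤ 1) :
    Function.update w i (fun l => (1 - t) * w i l + t * if l = j then 1 else 0) ∈
      groupSimplex S := by
  obtain ⟨h1, h2, h3⟩ := hw
  refine ⟨fun i' l => ?_, fun i' l hl => ?_, fun i' => ?_⟩ <;> by_cases hi : i' = i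
  · subst hi
    rw [Function.update_self]
    have := h1 i' l
    have : 0 ≤ 1 - t := by linarith
    split_ifs <;> positivity
  · rw [Function.update_of_ne hi]; exact h1 i' l
  · subst hi
    rw [Function.update_self, h2 i' l hl, if_neg (by rintro rfl; exact hl hj)]
    simp
  · rw [Function.update_of_ne hi]; exact h2 i' l hl
  · subst hi
    rw [Function.update_self, Finset.sum_add_distrib, ← Finset.mul_sum, ← Finset.mul_sum, h3,
      Finset.sum_ite_eq_of_mem' _ _ _ hj]
    ring
  · rw [Function.update_of_ne hi]; exact h3 i'

section Design
variable {ι κ : Type*} [Fintype ι] {n : ℕ} (S : ι → Finset κ) (a : κ → Fin n → ℝ) (v : ι → ℝ)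

/-- The information matrix of a group of vectors with weights `u`. -/
def groupMatrix (s : Finset κ) (u : κ → ℝ) : Matrix (Fin n) (Fin n) ℝ :=
  ∑ j ∈ s, u j • vecMulVec (a j) (a j)

/-- The regularised information matrix of a weighted family of groups. -/
def designMatrix (δ : ℝ) (w : ι → κ → ℝ) : Matrix (Fin n) (Fin n) ℝ :=
  δ • 1 + ∑ i, v i • groupMatrix a (S i) (w i)

theorem posSemidef_groupMatrix (s : Finset κ) {u : κ → ℝ} (hu : ∀ j, 0 ≤ u j) :
    (groupMatrix a s u).PosSemidef :=
  posSemidef_sum _ fun j _ => by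
    have := posSemidef_vecMulVec_self_star (a j)
    rw [star_trivial] at this
    exact this.smul (hu j)

variable {v} in
theorem posDef_designMatrix (hv : ∀ i, 0 ≤ v i) {δ : ℝ} (hδ : 0 < δ) {w : ι → κ → ℝ}
    (hw : ∀ i j, 0 ≤ w i j) : (designMatrix S a v δ w).PosDef :=
  (PosDef.one.smul hδ).add_posSemidef
    (posSemidef_sum _ fun i _ => (posSemidef_groupMatrix a (S i) (hw i)).smul (hv i))

theorem designMatrix_update (δ : ℝ) (w : ι → κ → ℝ) {i : ι} {j : κ} (hj : j ∈ S i) (t : ℝ) :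
    designMatrix S a v δ
      (Function.update w i (fun l => (1 - t) * w i l + t * if l = j then 1 else 0)) =
    designMatrix S a v δ w +
      t • (v i • (vecMulVec (a j) (a j) - groupMatrix a (S i) (w i))) := by
  have h1 : groupMatrix a (S i) (fun l => (1 - t) * w i l + t * if l = j then 1 else 0) =
      groupMatrix a (S i) (w i) + t • (vecMulVec (a j) (a j) - groupMatrix a (S i) (w i)) := by
    have : ∑ l ∈ S i, (t * if l = j then (1 : ℝ) else 0) • vecMulVec (a l) (a l) =
        t • vecMulVec (a j) (a j) := by
      rw [Finset.sum_eq_single_of_mem j hj fun l _ hl => by simp [hl]]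
      simp
    have e2 : ∑ l ∈ S i, ((1 - t) * w i l) • vecMulVec (a l) (a l) =
        (1 - t) • ∑ l ∈ S i, w i l • vecMulVec (a l) (a l) := by
      simp only [Finset.smul_sum, mul_smul]
    simp only [groupMatrix, add_smul, Finset.sum_add_distrib]
    rw [this, e2]
    module
  unfold designMatrix
  rw [← Finset.add_sum_erase _ _ (Finset.mem_univ i), ← Finset.add_sum_erase (a := i)
    (f := fun i => v i • groupMatrix a (S i) (w i)) _ (Finset.mem_univ i), Function.update_self, h1]
  have h2 : ∑ i' ∈ Finset.univ.erase i, v i' • groupMatrix a (S i')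
      (Function.update w i (fun l => (1 - t) * w i l + t * if l = j then 1 else 0) i') =
      ∑ i' ∈ Finset.univ.erase i, v i' • groupMatrix a (S i') (w i') :=
    Finset.sum_congr rfl fun i' hi' => by rw [Function.update_of_ne (Finset.ne_of_mem_erase hi')]
  rw [h2]
  module

variable {v} in
theorem exists_optimal_design (hS : ∀ i, (S i).Nonempty) (hv : ∀ i, 0 ≤ v i) {δ : ℝ} (hδ : 0 < δ) :
    ∃ w ∈ groupSimplex S, ∀ i, ∀ j ∈ S i,
      v i * trace ((designMatrix S a v δ w)⁻¹ * vecMulVec (a j) (a j)) ≤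
        v i * trace ((designMatrix S a v δ w)⁻¹ * groupMatrix a (S i) (w i)) := by
  choose j₀ hj₀ using hS
  have hne : (groupSimplex S).Nonempty :=
    ⟨fun i j => if j = j₀ i then 1 else 0, fun i j => by dsimp only; split_ifs <;> simp,
      fun i j hj => if_neg (by rintro rfl; exact hj (hj₀ i)),
      fun i => Finset.sum_ite_eq_of_mem' _ _ _ (hj₀ i)⟩
  obtain ⟨w, hw, hmax⟩ := (isCompact_groupSimplex S).exists_isMaxOn hne
    (f := fun w => det (designMatrix S a v δ w)) (Continuous.continuousOn (by
      unfold designMatrix groupMatrix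
      fun_prop))
  refine ⟨w, hw, fun i j hj => ?_⟩
  have := trace_inv_mul_le_of_isMaxOn (posDef_designMatrix S a hv hδ hw.1)
    (N := v i • (vecMulVec (a j) (a j) - groupMatrix a (S i) (w i))) (fun t ht ht1 => by
      rw [← designMatrix_update S a v δ w hj t]
      exact hmax (update_mem_groupSimplex hw hj ht.le ht1))
  rw [Matrix.mul_smul, trace_smul, mul_sub, trace_sub, smul_eq_mul, mul_sub] at this
  linarith

end Design

open scoped MatrixOrder in
theorem Matrix.PosDef.exists_transpose_mul_self {n : ℕ} {M : Matrix (Fin n) (Fin n) ℝ}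
    (hM : M.PosDef) : ∃ B : Matrix (Fin n) (Fin n) ℝ, IsUnit B.det ∧ M = Bᵀ * B := by
  obtain ⟨B, hB⟩ := CStarAlgebra.nonneg_iff_eq_star_mul_self.mp hM.posSemidef.nonneg
  have hB' : M = Bᵀ * B := by
    rw [hB, star_eq_conjTranspose, conjTranspose_eq_transpose_of_trivial]
  refine ⟨B, isUnit_iff_ne_zero.2 fun h => ?_, hB'⟩
  have := hM.det_pos
  rw [hB', det_mul, h, mul_zero] at this
  exact this.false

section Position
variable {ι κ : Type*} [Fintype ι] {n : ℕ} (S : ι → Finset κ) (a : κ → Fin n → ℝ) {v : ι → ℝ}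

theorem dotProduct_groupMatrix_mulVec (s : Finset κ) (u : κ → ℝ) (x : Fin n → ℝ) :
    x ⬝ᵥ groupMatrix a s u *ᵥ x = ∑ j ∈ s, u j * (a j ⬝ᵥ x) ^ 2 := by
  unfold groupMatrix
  rw [Matrix.sum_mulVec, dotProduct_sum]
  refine Finset.sum_congr rfl fun j _ => ?_
  rw [smul_mulVec, vecMulVec_mulVec, dotProduct_smul, dotProduct_smul]
  simp only [MulOpposite.smul_eq_mul_unop, MulOpposite.unop_op, smul_eq_mul]
  rw [dotProduct_comm x]
  ring

theorem exists_position (hS : ∀ i, (S i).Nonempty) (hv : ∀ i, 0 ≤ v i) {δ : ℝ} (hδ : 0 < δ) :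
    ∃ (B : Matrix (Fin n) (Fin n) ℝ) (c : κ → EuclideanSpace ℝ (Fin n)) (θ : ι → ℝ),
      (∀ j x, inner ℝ (c j) (WithLp.toLp 2 (B *ᵥ x)) = a j ⬝ᵥ x) ∧
      (∀ i, ∀ j ∈ S i, v i * ‖c j‖ ^ 2 ≤ θ i) ∧ (∀ i, 0 ≤ θ i) ∧ ∑ i, θ i ≤ n ∧
      ∀ x (g : ι → ℝ), (∀ i, ∀ j ∈ S i, (a j ⬝ᵥ x) ^ 2 ≤ g i) →
        ‖(WithLp.toLp 2 (B *ᵥ x) : EuclideanSpace ℝ (Fin n))‖ ^ 2 ≤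
          δ * (x ⬝ᵥ x) + ∑ i, v i * g i := by
  obtain ⟨w, ⟨hw0, -, hw1⟩, hopt⟩ := exists_optimal_design S a hS hv hδ
  have hM := posDef_designMatrix S a hv hδ hw0
  set M := designMatrix S a v δ w with hMdef
  obtain ⟨B, hB, hMB⟩ := hM.exists_transpose_mul_self
  have hMu : IsUnit M.det := isUnit_iff_ne_zero.2 hM.det_pos.ne'
  have hnorm : ∀ j, ‖(WithLp.toLp 2 ((B⁻¹)ᵀ *ᵥ a j) : EuclideanSpace ℝ (Fin n))‖ ^ 2 =
      trace (M⁻¹ * vecMulVec (a j) (a j)) := fun j => by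
    rw [← real_inner_self_eq_norm_sq, EuclideanSpace.inner_toLp_toLp, star_trivial, hMB,
      Matrix.mul_inv_rev, mul_vecMulVec, trace_vecMulVec, ← mulVec_mulVec,
      ← transpose_nonsing_inv, dotProduct_comm (B⁻¹ *ᵥ _), dotProduct_mulVec (a j),
      ← mulVec_transpose]
  refine ⟨B, fun j => WithLp.toLp 2 ((B⁻¹)ᵀ *ᵥ a j),
    fun i => v i * trace (M⁻¹ * groupMatrix a (S i) (w i)), fun j x => ?_, fun i j hj => ?_,
    fun i => ?_, ?_, fun x g hg => ?_⟩
  · rw [EuclideanSpace.inner_toLp_toLp, star_trivial, dotProduct_comm, mulVec_transpose,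
      ← dotProduct_mulVec, mulVec_mulVec, nonsing_inv_mul _ hB, one_mulVec]
  · rw [hnorm]; exact hopt i j hj
  · refine mul_nonneg (hv i) ?_
    rw [groupMatrix, Finset.mul_sum, trace_sum]
    refine Finset.sum_nonneg fun j _ => ?_
    rw [Matrix.mul_smul, trace_smul, ← hnorm]
    exact mul_nonneg (hw0 i j) (sq_nonneg _)
  · have e : ∑ i, v i * trace (M⁻¹ * groupMatrix a (S i) (w i)) = n - δ * trace M⁻¹ := by
      have h1 : ∑ i, v i • groupMatrix a (S i) (w i) = M - δ • 1 := by
        rw [hMdef, designMatrix]; abel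
      have h2 : trace (M⁻¹ * ∑ i, v i • groupMatrix a (S i) (w i)) = n - δ * trace M⁻¹ := by
        rw [h1, mul_sub, nonsing_inv_mul _ hMu, Matrix.mul_smul, Matrix.mul_one, trace_sub,
          trace_smul, trace_one, Fintype.card_fin, smul_eq_mul]
      rw [← h2, Finset.mul_sum, trace_sum]
      exact Finset.sum_congr rfl fun i _ => by rw [Matrix.mul_smul, trace_smul, smul_eq_mul]
    rw [e]
    have := mul_nonneg hδ.le hM.inv.posSemidef.trace_nonneg
    linarith
  · have e : ‖(WithLp.toLp 2 (B *ᵥ x) : EuclideanSpace ℝ (Fin n))‖ ^ 2 = x ⬝ᵥ M *ᵥ x := by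
      rw [← real_inner_self_eq_norm_sq, EuclideanSpace.inner_toLp_toLp, star_trivial, hMB,
        ← mulVec_mulVec, dotProduct_mulVec x, vecMul_transpose]
    rw [e, hMdef, designMatrix, add_mulVec, dotProduct_add, smul_mulVec, one_mulVec,
      dotProduct_smul, smul_eq_mul, Matrix.sum_mulVec, dotProduct_sum]
    gcongr with i
    rw [smul_mulVec, dotProduct_smul, smul_eq_mul, dotProduct_groupMatrix_mulVec]
    refine mul_le_mul_of_nonneg_left ?_ (hv i)
    calc _ ≤ ∑ j ∈ S i, w i j * g i :=
          Finset.sum_le_sum fun j hj => mul_le_mul_of_nonneg_left (hg i j hj) (hw0 i j)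
      _ = g i := by rw [← Finset.sum_mul, hw1, one_mul]

end Position

section Energy
variable {m n k : ℕ} (A : Matrix (Fin m) (Fin n) ℝ)

theorem abs_dotProduct_le_gval {T : Finset (Fin m)} {j : Fin m} (hj : j ∈ T) (x : Fin n → ℝ) :
    |A j ⬝ᵥ x| ≤ gval A T x := by
  rw [gval, dif_pos ⟨j, hj⟩]
  exact Finset.le_sup' (fun j => |A j ⬝ᵥ x|) hj

theorem gval_le {T : Finset (Fin m)} {x : Fin n → ℝ} {c : ℝ} (hc : 0 ≤ c)
    (h : ∀ j ∈ T, |A j ⬝ᵥ x| ≤ c) : gval A T x ≤ c := by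
  rw [gval]
  split_ifs with hT
  · exact Finset.sup'_le hT _ h
  · exact hc

theorem gval_nonneg (T : Finset (Fin m)) (x : Fin n → ℝ) : 0 ≤ gval A T x := by
  by_cases h : T.Nonempty
  · obtain ⟨j, hj⟩ := h
    exact (abs_nonneg _).trans (abs_dotProduct_le_gval A hj x)
  · rw [gval, dif_neg h]

theorem gval_smul_le (T : Finset (Fin m)) (c : ℝ) (x : Fin n → ℝ) :
    gval A T (c • x) ≤ |c| * gval A T x :=
  gval_le A (mul_nonneg (abs_nonneg _) (gval_nonneg A T x)) fun j hj => by
    rw [dotProduct_smul, smul_eq_mul, abs_mul]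
    exact mul_le_mul_of_nonneg_left (abs_dotProduct_le_gval A hj x) (abs_nonneg _)

theorem gval_smul (T : Finset (Fin m)) {c : ℝ} (hc : 0 < c) (x : Fin n → ℝ) :
    gval A T (c • x) = c * gval A T x := by
  refine le_antisymm ((gval_smul_le A T c x).trans_eq (by rw [abs_of_pos hc])) ?_
  have h := gval_smul_le A T c⁻¹ (c • x)
  rwa [inv_smul_smul₀ hc.ne', abs_of_pos (inv_pos.2 hc), le_inv_mul_iff₀ hc] at h

theorem wenergy_smul (S : Fin k → Finset (Fin m)) (v : Fin k → ℝ) {c : ℝ} (hc : 0 < c)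
    (x : Fin n → ℝ) : wenergy A S v (c • x) = c ^ 2 * wenergy A S v x := by
  rw [wenergy, wenergy, Finset.mul_sum]
  exact Finset.sum_congr rfl fun i _ => by rw [gval_smul A (S i) hc]; ring

theorem wenergy_nonneg (S : Fin k → Finset (Fin m)) {v : Fin k → ℝ} (hv : ∀ i, 0 ≤ v i)
    (x : Fin n → ℝ) : 0 ≤ wenergy A S v x :=
  Finset.sum_nonneg fun i _ => mul_nonneg (hv i) (sq_nonneg _)

theorem card_support_le_two_mul {v θ : Fin k → ℝ} (hθ : ∀ i, 0 ≤ θ i) (hn : 0 < n)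
    (hsum : ∑ i, θ i ≤ n) :
    ((Finset.univ.filter fun i => v i ≠ 0).card : ℝ) ≤ 2 * (Finset.univ.filter fun i =>
      v i ≠ 0 ∧ θ i ≤ 2 * n / (Finset.univ.filter fun i => v i ≠ 0).card).card := by
  set N := (Finset.univ.filter fun i => v i ≠ 0).card with hN
  have hsplit := Finset.card_filter_add_card_filter_not (s := Finset.univ.filter fun i => v i ≠ 0)
    (fun i => θ i ≤ 2 * n / (N : ℝ))
  rw [Finset.filter_filter, Finset.filter_filter, ← hN] at hsplit
  set J' := Finset.univ.filter fun i => v i ≠ 0 ∧ ¬ θ i ≤ 2 * n / (N : ℝ) with hJ'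
  have h1 : (J'.card : ℝ) * (2 * n / N) ≤ n := by
    refine le_trans ?_ hsum
    rw [← nsmul_eq_mul]
    refine (Finset.card_nsmul_le_sum J' θ _ fun i hi => ?_).trans
      (Finset.sum_le_sum_of_subset_of_nonneg (Finset.subset_univ _) fun i _ _ => hθ i)
    exact (not_le.1 (Finset.mem_filter.1 hi).2.2).le
  have h2 : (2 : ℝ) * J'.card ≤ N := by
    rcases N.eq_zero_or_pos with h0 | h0
    · have : J'.card = 0 := by omega
      rw [this]; simp
    · have hn' : (0 : ℝ) < n := by exact_mod_cast hn
      have h0' : (0 : ℝ) < N := by exact_mod_cast h0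
      rw [← mul_div_assoc, div_le_iff₀ h0'] at h1
      nlinarith
  have h3 : ((Finset.univ.filter fun i => v i ≠ 0 ∧ θ i ≤ 2 * n / (N : ℝ)).card : ℝ) +
      J'.card = N := by
    exact_mod_cast hsplit
  linarith

variable {A} {S : Fin k → Finset (Fin m)}

theorem exists_signs_on_finset {r : ℕ} (hS : ∀ i, (S i).Nonempty)
    (hdisj : ∀ i j, i ≠ j → Disjoint (S i) (S j)) (hr : ∀ i, (S i).card ≤ r) (hr2 : 2 ≤ r)
    (hrm : r ≤ m) (hn : 0 < n) {v : Fin k → ℝ} (hv : ∀ i, 0 ≤ v i) (hv0 : ∃ i, v i ≠ 0)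
    (T : Finset (Fin n → ℝ)) (hT : ∀ x ∈ T, wenergy A S v x ≤ 1) :
    ∃ σ : Fin k → ℝ, (∀ i, σ i = 0 ∨ σ i = 1 ∨ σ i = -1) ∧
      ((Finset.univ.filter fun i => v i ≠ 0).card : ℝ) ≤
        2 * (Finset.univ.filter fun i => v i ≠ 0 ∧ σ i ≠ 0).card ∧
      ∀ x ∈ T, |∑ i, σ i * (v i * gval A (S i) x ^ 2)| ≤ 10 * chainConst *
        √(2 * n / (Finset.univ.filter fun i => v i ≠ 0).card * log m * log r) := by
  obtain ⟨δ, hδ, hδT⟩ : ∃ δ : ℝ, 0 < δ ∧ ∀ x ∈ T, δ * (x ⬝ᵥ x) ≤ 1 := by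
    have h0 : ∀ x : Fin n → ℝ, 0 ≤ x ⬝ᵥ x := fun x =>
      Finset.sum_nonneg fun i _ => mul_self_nonneg (x i)
    have h1 : 0 ≤ ∑ x ∈ T, x ⬝ᵥ x := Finset.sum_nonneg fun x _ => h0 x
    refine ⟨(1 + ∑ x ∈ T, x ⬝ᵥ x)⁻¹, by positivity, fun x hx => ?_⟩
    rw [inv_mul_le_iff₀ (by positivity), mul_one]
    have := Finset.single_le_sum (f := fun x : Fin n → ℝ => x ⬝ᵥ x) (fun x _ => h0 x) hx
    linarith
  obtain ⟨B, c, θ, hc, hcθ, hθ, hθn, hB⟩ := exists_position S A hS hv hδ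
  have hJcard := card_support_le_two_mul (v := v) hθ hn hθn
  set N := (Finset.univ.filter fun i => v i ≠ 0).card with hN
  set τ : ℝ := 2 * n / N with hτ
  set J := Finset.univ.filter fun i => v i ≠ 0 ∧ θ i ≤ τ with hJ
  have hN0 : 0 < N := by
    obtain ⟨i, hi⟩ := hv0
    exact Finset.card_pos.2 ⟨i, by simpa using hi⟩
  have hτ0 : 0 < τ := by positivity
  let b : J → Fin m → EuclideanSpace ℝ (Fin n) := fun i j => √(v i) • c j
  let q : J → Fin m → Seminorm ℝ (EuclideanSpace ℝ (Fin n)) := fun i j =>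
    (normSeminorm ℝ ℝ).comp (innerSL ℝ (b i j)).toLinearMap
  have hq : ∀ i j y, q i j y = |inner ℝ (b i j) y| := fun i j y => rfl
  let p : J → Seminorm ℝ (EuclideanSpace ℝ (Fin n)) := fun i => (S i).sup (q i)
  have hpB : ∀ i x, p i (WithLp.toLp 2 (B *ᵥ x)) = √(v i) * gval A (S i) x := by
    intro i x
    have h1 : ∀ j, q i j (WithLp.toLp 2 (B *ᵥ x)) = √(v i) * |A j ⬝ᵥ x| := fun j => by
      rw [hq, real_inner_smul_left, hc, abs_mul, abs_of_nonneg (Real.sqrt_nonneg _)]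
    refine le_antisymm (Seminorm.finset_sup_apply_le
      (mul_nonneg (Real.sqrt_nonneg _) (gval_nonneg A _ x)) fun j hj => ?_) ?_
    · rw [h1]
      exact mul_le_mul_of_nonneg_left (abs_dotProduct_le_gval A hj x) (Real.sqrt_nonneg _)
    · have hvi : 0 < √(v i) :=
        Real.sqrt_pos.2 (lt_of_le_of_ne (hv i) (Finset.mem_filter.1 i.2).2.1.symm)
      rw [← le_div_iff₀' hvi]
      refine gval_le A (div_nonneg (apply_nonneg _ _) hvi.le) fun j hj => ?_
      rw [le_div_iff₀' hvi, ← h1]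
      exact Seminorm.le_finset_sup_apply hj
  have hpB2 : ∀ i x, p i (WithLp.toLp 2 (B *ᵥ x)) ^ 2 = v i * gval A (S i) x ^ 2 := fun i x => by
    rw [hpB, mul_pow, Real.sq_sqrt (hv i)]
  have hlog2 : (0 : ℝ) < log 2 := Real.log_pos one_lt_two
  have hl : log 2 ≤ log r := Real.log_le_log two_pos (by exact_mod_cast hr2)
  have hr0 : (0 : ℝ) < r := by positivity
  have hL : log 2 ≤ log m := hl.trans (Real.log_le_log hr0 (by exact_mod_cast hrm))
  have hm0 : (0 : ℝ) < m := hr0.trans_le (by exact_mod_cast hrm)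
  have hcardS : ∑ i : J, (S i).card ≤ m := by
    rw [← Finset.card_biUnion (s := Finset.univ) (t := fun i : J => S i)
      (fun i _ j _ hij => hdisj _ _ fun h => hij (Subtype.ext h))]
    exact (Finset.card_le_univ _).trans_eq (Fintype.card_fin m)
  have hcardJ : Fintype.card J ≤ m := by
    refine le_trans ?_ hcardS
    rw [← Finset.card_univ, Finset.card_eq_sum_ones]
    exact Finset.sum_le_sum fun i _ => Finset.card_pos.2 (hS i)
  obtain ⟨σ, hσ, hσT⟩ := exists_signs_of_groups p (fun i : J => S i) b
    (fun i y => by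
      rcases Seminorm.zero_or_exists_apply_eq_finset_sup (q i) (S i) y with h | ⟨j, hj, h⟩
      · exact Or.inl h
      · exact Or.inr ⟨j, hj, h⟩) hτ0
    (fun i j hj => by
      have h1 := (hcθ i j hj).trans (Finset.mem_filter.1 i.2).2.2
      simp only [b]
      rwa [norm_smul, mul_pow, Real.norm_of_nonneg (Real.sqrt_nonneg _), Real.sq_sqrt (hv i)])
    hl hL (by rw [Real.exp_log hm0]; exact_mod_cast hcardJ)
    (fun i => by rw [Real.exp_log hr0]; exact_mod_cast hr i)
    (by rw [Real.exp_log hm0]; exact_mod_cast hcardS)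
    (insert 0 (T.image fun x => WithLp.toLp 2 (B *ᵥ x))) (Finset.mem_insert_self _ _)
    (fun y hy => by
      rcases Finset.mem_insert.1 hy with rfl | hy
      · simp
      obtain ⟨x, hx, rfl⟩ := Finset.mem_image.1 hy
      have h1 := hB x (fun i => gval A (S i) x ^ 2) fun i j hj =>
        sq_le_sq.2 ((abs_dotProduct_le_gval A hj x).trans (le_abs_self _))
      have h2 := hδT x hx
      have h3 := hT x hx
      rw [wenergy] at h3
      linarith)
    (fun y hy => by
      rcases Finset.mem_insert.1 hy with rfl | hy
      · simp
      obtain ⟨x, hx, rfl⟩ := Finset.mem_image.1 hy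
      simp only [hpB2]
      refine le_trans ?_ (hT x hx)
      rw [Finset.sum_coe_sort J fun i => v i * gval A (S i) x ^ 2]
      exact Finset.sum_le_sum_of_subset_of_nonneg (Finset.subset_univ _) fun i _ _ =>
        mul_nonneg (hv i) (sq_nonneg _))
  let σ' : Fin k → ℝ := fun i => if h : i ∈ J then σ ⟨i, h⟩ else 0
  have hσ' : ∀ i : J, σ' i = σ i := fun i => dif_pos i.2
  refine ⟨σ', fun i => ?_, hJcard.trans ?_, fun x hx => ?_⟩
  · by_cases h : i ∈ J
    · exact Or.inr (by simpa only [σ', dif_pos h] using hσ ⟨i, h⟩)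
    · exact Or.inl (dif_neg h)
  · refine mul_le_mul_of_nonneg_left (Nat.cast_le.2 (Finset.card_le_card fun i hi => ?_)) two_pos.le
    refine Finset.mem_filter.2 ⟨Finset.mem_univ i, (Finset.mem_filter.1 hi).2.1, ?_⟩
    rw [hσ' ⟨i, hi⟩]
    rcases hσ ⟨i, hi⟩ with h | h <;> rw [h] <;> norm_num
  · have h1 := hσT _ (Finset.mem_insert_of_mem (Finset.mem_image_of_mem _ hx))
    simp only [hpB2] at h1
    convert h1 using 2
    simp only [← hσ']
    rw [Finset.sum_coe_sort J fun i => σ' i * (v i * gval A (S i) x ^ 2)]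
    refine (Finset.sum_subset (Finset.subset_univ _) fun i _ hi => ?_).symm
    simp only [σ', dif_neg hi, zero_mul]

end Energy

section Sparsify
variable {m n k r : ℕ} {A : Matrix (Fin m) (Fin n) ℝ} {S : Fin k → Finset (Fin m)}

theorem exists_signs_wenergy (hS : ∀ i, (S i).Nonempty)
    (hdisj : ∀ i j, i ≠ j → Disjoint (S i) (S j)) (hr : ∀ i, (S i).card ≤ r) (hr2 : 2 ≤ r)
    (hrm : r ≤ m) (hn : 0 < n) {v : Fin k → ℝ} (hv : ∀ i, 0 ≤ v i) (hv0 : ∃ i, v i ≠ 0) :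
    ∃ σ : Fin k → ℝ, (∀ i, σ i = 0 ∨ σ i = 1 ∨ σ i = -1) ∧
      ((Finset.univ.filter fun i => v i ≠ 0).card : ℝ) ≤
        2 * (Finset.univ.filter fun i => v i ≠ 0 ∧ σ i ≠ 0).card ∧
      ∀ x, |∑ i, σ i * (v i * gval A (S i) x ^ 2)| ≤ 10 * chainConst *
        √(2 * n / (Finset.univ.filter fun i => v i ≠ 0).card * log m * log r) *
          wenergy A S v x := by
  set β := 10 * chainConst *
    √(2 * n / (Finset.univ.filter fun i => v i ≠ 0).card * log m * log r) with hβ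
  have hβ0 : 0 ≤ β := mul_nonneg (by unfold chainConst; norm_num) (Real.sqrt_nonneg _)
  by_contra! hcon
  have hy : ∀ σ : Fin k → ℝ, ∃ y : Fin n → ℝ, wenergy A S v y ≤ 1 ∧
      ((∀ i, σ i = 0 ∨ σ i = 1 ∨ σ i = -1) →
        ((Finset.univ.filter fun i => v i ≠ 0).card : ℝ) ≤
          2 * (Finset.univ.filter fun i => v i ≠ 0 ∧ σ i ≠ 0).card →
        β < |∑ i, σ i * (v i * gval A (S i) y ^ 2)|) := by
    intro σ
    by_cases hσ : (∀ i, σ i = 0 ∨ σ i = 1 ∨ σ i = -1) ∧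
        ((Finset.univ.filter fun i => v i ≠ 0).card : ℝ) ≤
          2 * (Finset.univ.filter fun i => v i ≠ 0 ∧ σ i ≠ 0).card
    · obtain ⟨x, hx⟩ := hcon σ hσ.1 hσ.2
      have hle : |∑ i, σ i * (v i * gval A (S i) x ^ 2)| ≤ wenergy A S v x := by
        refine (Finset.abs_sum_le_sum_abs _ _).trans (Finset.sum_le_sum fun i _ => ?_)
        have h0 : 0 ≤ v i * gval A (S i) x ^ 2 := mul_nonneg (hv i) (sq_nonneg _)
        rw [abs_mul, abs_of_nonneg h0]
        rcases hσ.1 i with h | h | h <;> rw [h] <;> simp [h0]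
      have hf : 0 < wenergy A S v x :=
        ((mul_nonneg hβ0 (wenergy_nonneg A S hv x)).trans_lt hx).trans_le hle
      have hc : 0 < (√(wenergy A S v x))⁻¹ := inv_pos.2 (Real.sqrt_pos.2 hf)
      have hc2 : (√(wenergy A S v x))⁻¹ ^ 2 = (wenergy A S v x)⁻¹ := by
        rw [inv_pow, Real.sq_sqrt hf.le]
      refine ⟨(√(wenergy A S v x))⁻¹ • x, ?_, fun _ _ => ?_⟩
      · rw [wenergy_smul A S v hc, hc2, inv_mul_cancel₀ hf.ne']
      · have e : ∑ i, σ i * (v i * gval A (S i) ((√(wenergy A S v x))⁻¹ • x) ^ 2) =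
            (wenergy A S v x)⁻¹ * ∑ i, σ i * (v i * gval A (S i) x ^ 2) := by
          rw [Finset.mul_sum]
          exact Finset.sum_congr rfl fun i _ => by rw [gval_smul A (S i) hc, mul_pow, hc2]; ring
        rw [e, abs_mul, abs_of_pos (inv_pos.2 hf), lt_inv_mul_iff₀ hf, mul_comm]
        exact hx
    · refine ⟨0, ?_, fun h1 h2 => absurd ⟨h1, h2⟩ hσ⟩
      have h0 : ∀ i, gval A (S i) 0 = 0 := fun i =>
        le_antisymm (gval_le A le_rfl fun j _ => by simp) (gval_nonneg A _ _)
      simp [wenergy, h0]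
  choose y hy1 hy2 using hy
  obtain ⟨σ, hσ, hcard, hσT⟩ := exists_signs_on_finset (A := A) hS hdisj hr hr2 hrm hn hv hv0
    ((Fintype.piFinset fun _ : Fin k => ({0, 1, -1} : Finset ℝ)).image y) fun x hx => by
      obtain ⟨σ, -, rfl⟩ := Finset.mem_image.1 hx
      exact hy1 σ
  refine (hy2 σ hσ hcard).not_ge (hσT _ (Finset.mem_image_of_mem _ ?_))
  simpa using hσ

theorem exists_halving (hS : ∀ i, (S i).Nonempty)
    (hdisj : ∀ i j, i ≠ j → Disjoint (S i) (S j)) (hr : ∀ i, (S i).card ≤ r) (hr2 : 2 ≤ r)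
    (hrm : r ≤ m) (hn : 0 < n) {v : Fin k → ℝ} (hv : ∀ i, 0 ≤ v i) (hv0 : ∃ i, v i ≠ 0) :
    ∃ v' : Fin k → ℝ, (∀ i, 0 ≤ v' i) ∧
      4 * (Finset.univ.filter fun i => v' i ≠ 0).card ≤
        3 * (Finset.univ.filter fun i => v i ≠ 0).card ∧
      ∀ x, |wenergy A S v' x - wenergy A S v x| ≤ 10 * chainConst *
        √(2 * n * log m * log r) / √(Finset.univ.filter fun i => v i ≠ 0).card *
          wenergy A S v x := by
  obtain ⟨σ, hσ, hcard, hσx⟩ := exists_signs_wenergy (A := A) hS hdisj hr hr2 hrm hn hv hv0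
  obtain ⟨s, hs, hsJ⟩ : ∃ s : ℝ, (s = 1 ∨ s = -1) ∧
      (Finset.univ.filter fun i => v i ≠ 0 ∧ σ i ≠ 0).card ≤
        2 * (Finset.univ.filter fun i => v i ≠ 0 ∧ s * σ i = -1).card := by
    have hsub : (Finset.univ.filter fun i => v i ≠ 0 ∧ σ i ≠ 0) ⊆
        (Finset.univ.filter fun i => v i ≠ 0 ∧ 1 * σ i = -1) ∪
          Finset.univ.filter fun i => v i ≠ 0 ∧ -1 * σ i = -1 := by
      intro i hi
      obtain ⟨-, h1, h2⟩ := Finset.mem_filter.1 hi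
      rw [Finset.mem_union, Finset.mem_filter, Finset.mem_filter]
      rcases (hσ i).resolve_left h2 with h | h <;> rw [h] <;> norm_num [h1]
    have h := (Finset.card_le_card hsub).trans (Finset.card_union_le _ _)
    by_cases hc : (Finset.univ.filter fun i => v i ≠ 0 ∧ σ i ≠ 0).card ≤
        2 * (Finset.univ.filter fun i => v i ≠ 0 ∧ 1 * σ i = -1).card
    · exact ⟨1, Or.inl rfl, hc⟩
    · exact ⟨-1, Or.inr rfl, by omega⟩
  refine ⟨fun i => v i * (1 + s * σ i), fun i => mul_nonneg (hv i) ?_, ?_, fun x => ?_⟩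
  · rcases hs with h | h <;> rcases hσ i with h' | h' | h' <;> rw [h, h'] <;> norm_num
  · have hsub : (Finset.univ.filter fun i => v i * (1 + s * σ i) ≠ 0) ⊆
        (Finset.univ.filter fun i => v i ≠ 0) \
          Finset.univ.filter fun i => v i ≠ 0 ∧ s * σ i = -1 := by
      intro i hi
      have h := (Finset.mem_filter.1 hi).2
      simp only [Finset.mem_sdiff, Finset.mem_filter, Finset.mem_univ, true_and]
      exact ⟨left_ne_zero_of_mul h, fun h1 => h (by rw [h1.2]; ring)⟩
    have h1 := Finset.card_le_card hsub
    rw [Finset.card_sdiff_of_subset (Finset.monotone_filter_right _ fun i _ hi => hi.1)] at h1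
    have h2 : (Finset.univ.filter fun i => v i ≠ 0).card ≤
        2 * (Finset.univ.filter fun i => v i ≠ 0 ∧ σ i ≠ 0).card := by exact_mod_cast hcard
    have h3 : (Finset.univ.filter fun i => v i ≠ 0 ∧ s * σ i = -1).card ≤
        (Finset.univ.filter fun i => v i ≠ 0).card :=
      Finset.card_le_card (Finset.monotone_filter_right _ fun i _ hi => hi.1)
    dsimp only
    omega
  · have e : wenergy A S (fun i => v i * (1 + s * σ i)) x - wenergy A S v x =
        s * ∑ i, σ i * (v i * gval A (S i) x ^ 2) := by
      rw [wenergy, wenergy, ← Finset.sum_sub_distrib, Finset.mul_sum]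
      exact Finset.sum_congr rfl fun i _ => by ring
    have hs1 : |s| = 1 := by rcases hs with h | h <;> rw [h] <;> simp
    rw [e, abs_mul, hs1, one_mul, mul_div_assoc, ← Real.sqrt_div' _ (Nat.cast_nonneg _)]
    convert hσx x using 4
    ring

theorem exists_sparsifier_of_halving {q ε : ℝ} (hq : 0 < q) (hε : 0 < ε) (hε1 : ε < 1)
    (hstep : ∀ v : Fin k → ℝ, (∀ i, 0 ≤ v i) → (∃ i, v i ≠ 0) →
      ∃ v' : Fin k → ℝ, (∀ i, 0 ≤ v' i) ∧
        4 * (Finset.univ.filter fun i => v' i ≠ 0).card ≤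
          3 * (Finset.univ.filter fun i => v i ≠ 0).card ∧
        ∀ x, |wenergy A S v' x - wenergy A S v x| ≤
          q / √(Finset.univ.filter fun i => v i ≠ 0).card * wenergy A S v x)
    {v : Fin k → ℝ} (hv : ∀ i, 0 ≤ v i)
    (hN : (56 * q / ε) ^ 2 < (Finset.univ.filter fun i => v i ≠ 0).card) :
    ∃ v' : Fin k → ℝ, (∀ i, 0 ≤ v' i) ∧
      ((Finset.univ.filter fun i => v' i ≠ 0).card : ℝ) ≤ (56 * q / ε) ^ 2 ∧
      ∀ x, wenergy A S v' x ≤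
          exp (ε / 2 - 14 * (q / √(Finset.univ.filter fun i => v i ≠ 0).card)) * wenergy A S v x ∧
        wenergy A S v x ≤
          exp (ε / 2 - 14 * (q / √(Finset.univ.filter fun i => v i ≠ 0).card)) *
            wenergy A S v' x := by
  induction hc : (Finset.univ.filter fun i => v i ≠ 0).card using Nat.strong_induction_on
    generalizing v with
  | _ N ih =>
  rw [hc] at hN
  have hN0 : (0 : ℝ) < N := (sq_nonneg _).trans_lt hN
  have hsq : 56 * q / ε < √N := Real.lt_sqrt_of_sq_lt hN
  have hsN : 0 < √(N : ℝ) := Real.sqrt_pos.2 hN0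
  set u := q / √N with hu
  have hu0 : 0 < u := div_pos hq hsN
  have huε : 56 * u < ε := by
    rw [div_lt_iff₀ hε] at hsq
    rw [hu, ← mul_div_assoc, div_lt_iff₀ hsN]
    linarith
  have hne : ∃ i, v i ≠ 0 := by
    have : 0 < (Finset.univ.filter fun i => v i ≠ 0).card := by rw [hc]; exact_mod_cast hN0
    obtain ⟨i, hi⟩ := Finset.card_pos.1 this
    exact ⟨i, (Finset.mem_filter.1 hi).2⟩
  obtain ⟨w, hw, hcard, hwx⟩ := hstep v hv hne
  rw [hc, ← hu] at hwx
  rw [hc] at hcard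
  have hwx' : ∀ x, wenergy A S w x ≤ exp (2 * u) * wenergy A S v x ∧
      wenergy A S v x ≤ exp (2 * u) * wenergy A S w x := by
    intro x
    have h0 := wenergy_nonneg A S hv x
    have h1 := wenergy_nonneg A S hw x
    obtain ⟨h2, h3⟩ := abs_le.1 (hwx x)
    have h4 : 1 + 2 * u ≤ exp (2 * u) := by linarith [Real.add_one_le_exp (2 * u)]
    constructor
    · nlinarith
    · refine le_trans ?_ (mul_le_mul_of_nonneg_right h4 h1)
      nlinarith [mul_nonneg hu0.le h0]
  by_cases hw' : ((Finset.univ.filter fun i => w i ≠ 0).card : ℝ) ≤ (56 * q / ε) ^ 2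
  · have hexp : exp (2 * u) ≤ exp (ε / 2 - 14 * u) := Real.exp_le_exp.2 (by linarith)
    exact ⟨w, hw, hw', fun x =>
      ⟨(hwx' x).1.trans (mul_le_mul_of_nonneg_right hexp (wenergy_nonneg A S hv x)),
        (hwx' x).2.trans (mul_le_mul_of_nonneg_right hexp (wenergy_nonneg A S hw x))⟩⟩
  · have hN' : 0 < N := by exact_mod_cast hN0
    obtain ⟨v', hv', hcard', hx'⟩ := ih _ (by omega) hw (not_le.1 hw') rfl
    set N' := (Finset.univ.filter fun i => w i ≠ 0).card with hN'def
    set u' := q / √(N' : ℝ) with hu'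
    have huu : 16 * u ≤ 14 * u' := by
      have h0 : (0 : ℝ) < N' := (sq_nonneg _).trans_lt (not_le.1 hw')
      have h1 : √(N' : ℝ) ≤ 7 / 8 * √N := by
        refine Real.sqrt_le_iff.2 ⟨by positivity, ?_⟩
        rw [mul_pow, Real.sq_sqrt hN0.le]
        have : (4 : ℝ) * N' ≤ 3 * N := by exact_mod_cast hcard
        linarith
      have h2 : u' * √(N' : ℝ) = q := div_mul_cancel₀ _ (Real.sqrt_pos.2 h0).ne'
      have h3 : u * √(N : ℝ) = q := div_mul_cancel₀ _ hsN.ne'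
      have h4 : 0 < u' := div_pos hq (Real.sqrt_pos.2 h0)
      refine le_of_mul_le_mul_right ?_ hsN
      nlinarith
    have hexp : exp (ε / 2 - 14 * u') * exp (2 * u) ≤ exp (ε / 2 - 14 * u) := by
      rw [← Real.exp_add]
      exact Real.exp_le_exp.2 (by linarith)
    refine ⟨v', hv', hcard', fun x => ⟨?_, ?_⟩⟩
    · calc _ ≤ _ := (hx' x).1
        _ ≤ exp (ε / 2 - 14 * u') * (exp (2 * u) * wenergy A S v x) :=
          mul_le_mul_of_nonneg_left (hwx' x).1 (Real.exp_pos _).le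
        _ ≤ _ := by
          rw [← mul_assoc]
          exact mul_le_mul_of_nonneg_right hexp (wenergy_nonneg A S hv x)
    · calc _ ≤ _ := (hwx' x).2
        _ ≤ exp (2 * u) * (exp (ε / 2 - 14 * u') * wenergy A S v' x) :=
          mul_le_mul_of_nonneg_left (hx' x).2 (Real.exp_pos _).le
        _ ≤ _ := by
          rw [← mul_assoc, mul_comm (exp (2 * u))]
          exact mul_le_mul_of_nonneg_right hexp (wenergy_nonneg A S hv' x)

end Sparsify

theorem exp_half_le_one_add {ε : ℝ} (hε : 0 ≤ ε) (hε1 : ε ≤ 1) : exp (ε / 2) ≤ 1 + ε := by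
  have h1 : 1 - ε / 2 ≤ exp (-(ε / 2)) := by linarith [Real.add_one_le_exp (-(ε / 2))]
  rw [Real.exp_neg] at h1
  have h2 := (le_inv_comm₀ (by linarith) (Real.exp_pos _)).1 h1
  refine h2.trans ?_
  rw [inv_le_iff_one_le_mul₀ (by linarith)]
  nlinarith

theorem stmt_1 :
    ∃ C : ℝ, 0 < C ∧
      ∀ (m n k r : ℕ) (A : Matrix (Fin m) (Fin n) ℝ) (S : Fin k → Finset (Fin m)),
        -- `S` is a partition of `[m]` into nonempty groups, and `r = max_i |S_i| ≥ 2`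
        (∀ i, (S i).Nonempty) →
        (∀ i j, i ≠ j → Disjoint (S i) (S j)) →
        (∀ a : Fin m, ∃ i, a ∈ S i) →
        (∀ i, (S i).card ≤ r) → (∃ i, (S i).card = r) → 2 ≤ r →
        -- nonnegative group weights `v`
        ∀ v : Fin k → ℝ, (∀ i, 0 ≤ v i) →
        ∀ ε : ℝ, 0 < ε → ε < 1 →
        ∃ v' : Fin k → ℝ, (∀ i, 0 ≤ v' i) ∧
          (((Finset.univ.filter fun i => v' i ≠ 0).card : ℝ) ≤
            C * n * ε⁻¹ ^ 2 * Real.log m * Real.log r) ∧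
          ∀ x : Fin n → ℝ,
            (1 + ε)⁻¹ * wenergy A S v' x ≤ wenergy A S v x ∧
              wenergy A S v x ≤ (1 + ε) * wenergy A S v' x := by
  have hC : 0 < chainConst := by unfold chainConst; norm_num
  refine ⟨2 * (560 * chainConst) ^ 2, by positivity, ?_⟩
  intro m n k r A S hS hdisj _ hr ⟨i₀, hi₀⟩ hr2 v hv ε hε hε1
  have hrm : r ≤ m := hi₀ ▸ (Finset.card_le_univ _).trans_eq (Fintype.card_fin m)
  have hlr : 0 < log r := Real.log_pos (by exact_mod_cast hr2)
  have hlm : 0 < log m := Real.log_pos (by exact_mod_cast hr2.trans hrm)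
  have hε' : 0 < 1 + ε := by linarith
  rcases n.eq_zero_or_pos with rfl | hn
  · have h0 : ∀ (w : Fin k → ℝ) (x : Fin 0 → ℝ), wenergy A S w x = 0 := fun w x =>
      Finset.sum_eq_zero fun i _ => by
        have : gval A (S i) x = 0 :=
          le_antisymm (gval_le A le_rfl fun j _ => by simp) (gval_nonneg A _ _)
        rw [this]; ring
    exact ⟨0, fun _ => le_rfl, by simp, fun x => by simp [h0]⟩
  have hn' : (0 : ℝ) < n := by exact_mod_cast hn
  set q := 10 * chainConst * √(2 * n * log m * log r) with hqdef
  have hq : 0 < q := by positivity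
  have hbound : (56 * q / ε) ^ 2 =
      2 * (560 * chainConst) ^ 2 * n * ε⁻¹ ^ 2 * Real.log m * Real.log r := by
    have : √(2 * n * log m * log r) ^ 2 = 2 * n * log m * log r := Real.sq_sqrt (by positivity)
    calc _ = (560 * chainConst) ^ 2 * ε⁻¹ ^ 2 * √(2 * n * log m * log r) ^ 2 := by
          rw [hqdef]; ring
      _ = _ := by rw [this]; ring
  rw [← hbound]
  by_cases hN : (56 * q / ε) ^ 2 < (Finset.univ.filter fun i => v i ≠ 0).card
  · obtain ⟨v', hv', hcard, hx⟩ := exists_sparsifier_of_halving (A := A) (S := S) hq hε hε1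
      (fun w hw hw0 => exists_halving hS hdisj hr hr2 hrm hn hw hw0) hv hN
    have hexp : exp (ε / 2 - 14 * (q / √(Finset.univ.filter fun i => v i ≠ 0).card)) ≤ 1 + ε :=
      (Real.exp_le_exp.2 (by linarith [div_nonneg hq.le (Real.sqrt_nonneg
        ((Finset.univ.filter fun i => v i ≠ 0).card : ℝ))])).trans
        (exp_half_le_one_add hε.le hε1.le)
    refine ⟨v', hv', hcard, fun x => ⟨?_, ?_⟩⟩
    · rw [inv_mul_le_iff₀ hε']
      exact (hx x).1.trans (mul_le_mul_of_nonneg_right hexp (wenergy_nonneg A S hv x))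
    · exact (hx x).2.trans (mul_le_mul_of_nonneg_right hexp (wenergy_nonneg A S hv' x))
  · refine ⟨v, hv, not_lt.1 hN, fun x => ?_⟩
    have h0 := wenergy_nonneg A S hv x
    refine ⟨?_, by nlinarith⟩
    rw [inv_mul_le_iff₀ hε']
    nlinarith
end

section
/- Let G = (S, A) be a rank-r unit matrix hypergraph with A ∈ ℝ^{m×n} whose rows are all nonzero, let T ≥ 1 be an integer and ν > 0. Suppose w^{(1)}, …, w^{(T)} ∈ ℝ_{>0}^m and σ̃^{(1)}, …, σ̃^{(T)} ∈ ℝ_{>0}^m satisfy: w^{(1)}_j = 1/|S_i| for all i ∈ [k] and j ∈ S_i; for each t ∈ [T], ‖σ̃^{(t)}‖₁ ≤ ν and σ̃^{(t)}_j ≥ σ_j(W^{(t)1/2} A) for all j ∈ [m] where W^{(t)} = diag(w^{(t)}); and w^{(t+1)}_j = σ̃^{(t)}_j / (Σ_{j'∈S_i} σ̃^{(t)}_{j'}) for all i ∈ [k], j ∈ S_i, and t ∈ [T]. Define τ ∈ ℝ^k by τ_i = exp(T^{-1} log r) · (1/T) Σ_{t∈[T]} Σ_{j∈S_i} σ̃^{(t)}_j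 and w̄ = (1/T) Σ_{t∈[T]} w^{(t)}. Then τ is an exp(T^{-1} log r)·ν-bounded group leverage score overestimate for G with associated weights w̄. -/
open Finset Matrix Real MeasureTheory
open scoped Classical

/-- The Moore–Penrose pseudoinverse of a square real matrix, defined as the (unique, when it
exists) matrix satisfying the four Penrose conditions, and `0` if no such matrix exists. -/
noncomputable def mpinv {n : ℕ} (M : Matrix (Fin n) (Fin n) ℝ) : Matrix (Fin n) (Fin n) ℝ :=
  if h : ∃ X : Matrix (Fin n) (Fin n) ℝ,
      M * X * M = M ∧ X * M * X = X ∧ (M * X)ᵀ = M * X ∧ (X * M)ᵀ = X * M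
  then h.choose else 0

/-- The leverage score of row `j` of `M`: `σ_j(M) = m_jᵀ (Mᵀ M)† m_j`. -/
noncomputable def levScore {m n : ℕ} (M : Matrix (Fin m) (Fin n) ℝ) (j : Fin m) : ℝ :=
  M j ⬝ᵥ ((mpinv (Mᵀ * M)) *ᵥ M j)

/-- The row-reweighted matrix `W^{1/2} A` for `W = diag w`. -/
noncomputable def rowScale {m n : ℕ} (A : Matrix (Fin m) (Fin n) ℝ) (w : Fin m → ℝ) :
    Matrix (Fin m) (Fin n) ℝ :=
  Matrix.of fun j l => Real.sqrt (w j) * A j l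

theorem exists_penrose_inverse {n : ℕ} {M : Matrix (Fin n) (Fin n) ℝ} (hM : M.IsHermitian) :
    ∃ X : Matrix (Fin n) (Fin n) ℝ,
      M * X * M = M ∧ X * M * X = X ∧ (M * X)ᵀ = M * X ∧ (X * M)ᵀ = X * M := by
  obtain ⟨U, D, hU, hMD⟩ : ∃ (U : Matrix (Fin n) (Fin n) ℝ) (D : Fin n → ℝ),
      Uᵀ * U = 1 ∧ M = U * diagonal D * Uᵀ := by
    refine ⟨hM.eigenvectorUnitary, hM.eigenvalues, ?_, ?_⟩
    · simpa [star_eq_conjTranspose] using Unitary.coe_star_mul_self hM.eigenvectorUnitary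
    · conv_lhs => rw [hM.spectral_theorem]
      simp [Unitary.conjStarAlgAut_apply, star_eq_conjTranspose]
  have hmul : ∀ d e : Fin n → ℝ, U * diagonal d * Uᵀ * (U * diagonal e * Uᵀ) =
      U * diagonal (fun i => d i * e i) * Uᵀ := fun d e => by
    calc _ = U * diagonal d * (Uᵀ * U) * diagonal e * Uᵀ := by simp only [Matrix.mul_assoc]
      _ = _ := by rw [hU, Matrix.mul_one, Matrix.mul_assoc U, diagonal_mul_diagonal]
  refine ⟨U * diagonal (fun i => (D i)⁻¹) * Uᵀ, ?_, ?_, ?_, ?_⟩ <;> subst hMD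
  · simp only [hmul, mul_inv_mul_cancel]
  · have hD : ∀ i, (D i)⁻¹ * D i * (D i)⁻¹ = (D i)⁻¹ := fun i => by
      simpa using mul_inv_mul_cancel (D i)⁻¹
    simp only [hmul, hD]
  all_goals
    rw [hmul]
    simp only [transpose_mul, diagonal_transpose, transpose_transpose, Matrix.mul_assoc]

theorem dotProduct_mpinv_mulVec {n : ℕ} {M : Matrix (Fin n) (Fin n) ℝ} (hM : M.IsHermitian)
    {a y : Fin n → ℝ} (hy : M *ᵥ y = a) : a ⬝ᵥ (mpinv M *ᵥ a) = a ⬝ᵥ y := by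
  have hX : M * mpinv M * M = M := by
    have h := exists_penrose_inverse hM
    rw [mpinv, dif_pos h]
    exact h.choose_spec.1
  have hMT : Mᵀ = M := by simpa using hM.eq
  have hvec : y ᵥ* M = a := by rw [← mulVec_transpose, hMT, hy]
  calc a ⬝ᵥ (mpinv M *ᵥ a) = y ᵥ* M ⬝ᵥ (mpinv M *ᵥ (M *ᵥ y)) := by rw [hvec, hy]
    _ = y ⬝ᵥ ((M * mpinv M * M) *ᵥ y) := by
      rw [← dotProduct_mulVec, mulVec_mulVec, mulVec_mulVec, Matrix.mul_assoc]
    _ = a ⬝ᵥ y := by rw [hX, hy, dotProduct_comm]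

theorem isHermitian_weightedGram {m n : ℕ} (A : Matrix (Fin m) (Fin n) ℝ) (w : Fin m → ℝ) :
    (Aᵀ * diagonal w * A).IsHermitian := by
  simp [Matrix.IsHermitian, transpose_mul, Matrix.mul_assoc]

theorem dotProduct_weightedGram_mulVec {m n : ℕ} (A : Matrix (Fin m) (Fin n) ℝ) (w : Fin m → ℝ)
    (x y : Fin n → ℝ) :
    x ⬝ᵥ ((Aᵀ * diagonal w * A) *ᵥ y) = ∑ l, w l * (A l ⬝ᵥ x) * (A l ⬝ᵥ y) := by
  rw [Matrix.mul_assoc, ← mulVec_mulVec, dotProduct_mulVec, vecMul_transpose, ← mulVec_mulVec]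
  refine Finset.sum_congr rfl fun l _ => ?_
  rw [mulVec_diagonal]
  simp only [mulVec]
  ring

theorem rowScale_transpose_mul_self {m n : ℕ} (A : Matrix (Fin m) (Fin n) ℝ) {w : Fin m → ℝ}
    (hw : ∀ j, 0 ≤ w j) : (rowScale A w)ᵀ * rowScale A w = Aᵀ * diagonal w * A := by
  have hB : rowScale A w = diagonal (fun j => √(w j)) * A := by
    ext j l
    simp [rowScale]
  rw [hB, transpose_mul, diagonal_transpose, Matrix.mul_assoc,
    ← Matrix.mul_assoc (diagonal fun j => √(w j)), diagonal_mul_diagonal, ← Matrix.mul_assoc]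
  simp only [Real.mul_self_sqrt (hw _)]

theorem exists_transpose_mul_self_mulVec_eq {m n : ℕ} (B : Matrix (Fin m) (Fin n) ℝ)
    (z : Fin m → ℝ) : ∃ y, (Bᵀ * B) *ᵥ y = Bᵀ *ᵥ z := by
  have hle : LinearMap.range (Bᵀ * B).mulVecLin ≤ LinearMap.range Bᵀ.mulVecLin := by
    rw [mulVecLin_mul]
    exact LinearMap.range_comp_le_range _ _
  have heq := Submodule.eq_of_le_of_finrank_eq hle
    (show (Bᵀ * B).rank = Bᵀ.rank by rw [rank_transpose_mul_self, rank_transpose])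
  have hz : Bᵀ.mulVecLin z ∈ LinearMap.range (Bᵀ * B).mulVecLin := heq ▸ ⟨z, rfl⟩
  exact hz

theorem exists_weightedGram_mulVec_eq_row {m n : ℕ} (A : Matrix (Fin m) (Fin n) ℝ)
    {w : Fin m → ℝ} (hw : ∀ j, 0 < w j) (j : Fin m) :
    ∃ y, (Aᵀ * diagonal w * A) *ᵥ y = A j := by
  obtain ⟨y, hy⟩ := exists_transpose_mul_self_mulVec_eq (rowScale A w)
    (Pi.single j (√(w j))⁻¹)
  refine ⟨y, ?_⟩
  rw [← rowScale_transpose_mul_self A fun j => (hw j).le, hy]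
  ext l
  have := (Real.sqrt_pos.2 (hw j)).ne'
  simp [rowScale]
  field_simp

theorem levScore_rowScale {m n : ℕ} (A : Matrix (Fin m) (Fin n) ℝ) {w : Fin m → ℝ}
    (hw : ∀ j, 0 ≤ w j) (j : Fin m) :
    levScore (rowScale A w) j =
      w j * (A j ⬝ᵥ (mpinv (Aᵀ * diagonal w * A) *ᵥ A j)) := by
  have hrow : rowScale A w j = √(w j) • A j := rfl
  rw [levScore, rowScale_transpose_mul_self A hw, hrow, mulVec_smul, smul_dotProduct,
    dotProduct_smul, smul_smul, Real.mul_self_sqrt (hw j), smul_eq_mul]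

/-- The Cauchy–Schwarz inequality for the form `Aᵀ W A` and its pseudoinverse. -/
theorem sq_row_dotProduct_le {m n : ℕ} (A : Matrix (Fin m) (Fin n) ℝ) {w : Fin m → ℝ}
    (hw : ∀ j, 0 < w j) (j : Fin m) (x : Fin n → ℝ) :
    (A j ⬝ᵥ x) ^ 2 ≤ (A j ⬝ᵥ (mpinv (Aᵀ * diagonal w * A) *ᵥ A j)) *
      ∑ l, w l * (A l ⬝ᵥ x) ^ 2 := by
  obtain ⟨y, hy⟩ := exists_weightedGram_mulVec_eq_row A hw j
  rw [dotProduct_mpinv_mulVec (isHermitian_weightedGram A w) hy]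
  have h1 : A j ⬝ᵥ x = ∑ l, w l * (A l ⬝ᵥ x) * (A l ⬝ᵥ y) := by
    rw [← dotProduct_weightedGram_mulVec, hy, dotProduct_comm]
  have h2 : A j ⬝ᵥ y = ∑ l, w l * (A l ⬝ᵥ y) ^ 2 := by
    conv_lhs => rw [← hy, dotProduct_comm, dotProduct_weightedGram_mulVec]
    exact Finset.sum_congr rfl fun l _ => by ring
  rw [h1, h2]
  refine Finset.sum_sq_le_sum_mul_sum_of_sq_le_mul _
    (fun l _ => mul_nonneg (hw l).le (sq_nonneg _))
    (fun l _ => mul_nonneg (hw l).le (sq_nonneg _)) fun l _ => le_of_eq (by ring)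

/-- Concavity of `w ↦ 1 / (aᵀ (Aᵀ W A)† a)`, in a form adapted to averages of weights. -/
theorem row_mpinv_mul_sum_div_le_one {m n : ℕ} {ι : Type*} (A : Matrix (Fin m) (Fin n) ℝ)
    (s : Finset ι) {c : ℝ} (hc : 0 ≤ c) (w u : ι → Fin m → ℝ) (v : Fin m → ℝ)
    (hv : ∀ j, v j = c * ∑ t ∈ s, w t j) (hvpos : ∀ j, 0 < v j)
    (hw : ∀ t ∈ s, ∀ j, 0 < w t j) (hu : ∀ t ∈ s, ∀ j, 0 < u t j)
    (hlev : ∀ t ∈ s, ∀ j, levScore (rowScale A (w t)) j ≤ u t j) (j : Fin m)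
    (hpos : 0 < A j ⬝ᵥ (mpinv (Aᵀ * diagonal v * A) *ᵥ A j)) :
    (A j ⬝ᵥ (mpinv (Aᵀ * diagonal v * A) *ᵥ A j)) * (c * ∑ t ∈ s, w t j / u t j) ≤ 1 := by
  obtain ⟨y, hy⟩ := exists_weightedGram_mulVec_eq_row A hvpos j
  rw [dotProduct_mpinv_mulVec (isHermitian_weightedGram A v) hy] at hpos ⊢
  have hq : A j ⬝ᵥ y = c * ∑ t ∈ s, ∑ l, w t l * (A l ⬝ᵥ y) ^ 2 := by
    conv_lhs => rw [← hy, dotProduct_comm, dotProduct_weightedGram_mulVec]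
    rw [Finset.sum_comm, Finset.mul_sum]
    refine Finset.sum_congr rfl fun l _ => ?_
    rw [hv, ← Finset.sum_mul]
    ring
  have hterm : ∀ t ∈ s, (A j ⬝ᵥ y) ^ 2 * (w t j / u t j) ≤ ∑ l, w t l * (A l ⬝ᵥ y) ^ 2 := by
    intro t ht
    have hcs := sq_row_dotProduct_le A (hw t ht) j y
    have hl := hlev t ht j
    rw [levScore_rowScale A (fun j => (hw t ht j).le)] at hl
    have hQ : 0 ≤ ∑ l, w t l * (A l ⬝ᵥ y) ^ 2 :=
      Finset.sum_nonneg fun l _ => mul_nonneg (hw t ht l).le (sq_nonneg _)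
    rw [← mul_div_assoc, div_le_iff₀ (hu t ht j)]
    have h1 := mul_le_mul_of_nonneg_left hcs (hw t ht j).le
    have h2 := mul_le_mul_of_nonneg_right hl hQ
    linarith
  have hsum : (A j ⬝ᵥ y) ^ 2 * (c * ∑ t ∈ s, w t j / u t j) ≤ A j ⬝ᵥ y := by
    conv_rhs => rw [hq]
    rw [mul_left_comm, Finset.mul_sum]
    exact mul_le_mul_of_nonneg_left (Finset.sum_le_sum hterm) hc
  nlinarith

theorem prod_le_avg_pow {ι : Type*} (s : Finset ι) (hs : s.Nonempty) (z : ι → ℝ)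
    (hz : ∀ i ∈ s, 0 ≤ z i) : ∏ i ∈ s, z i ≤ (1 / (s.card : ℝ) * ∑ i ∈ s, z i) ^ s.card := by
  have hcard : (0 : ℝ) < s.card := by exact_mod_cast hs.card_pos
  have h := Real.geom_mean_le_arith_mean s (fun _ => 1) z (fun _ _ => zero_le_one)
    (by simpa using hs) hz
  simp only [Real.rpow_one, one_mul, Finset.sum_const, nsmul_eq_mul, mul_one] at h
  have h' := pow_le_pow_left₀ (Real.rpow_nonneg (Finset.prod_nonneg hz) _) h s.card
  rwa [Real.rpow_inv_natCast_pow (Finset.prod_nonneg hz) hs.card_pos.ne', div_eq_inv_mul,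
    ← one_div] at h'

theorem prod_Icc_mul_succ {M : Type*} [CommMonoid M] (f : ℕ → M) (T : ℕ) :
    (∏ t ∈ Finset.Icc 1 T, f t) * f (T + 1) = f 1 * ∏ t ∈ Finset.Icc 1 T, f (t + 1) := by
  induction T with
  | zero => simp
  | succ T ih =>
    rw [Finset.prod_Icc_succ_top (by omega), Finset.prod_Icc_succ_top (by omega), ih, mul_assoc]

theorem stmt_4 {m n k r : ℕ} (A : Matrix (Fin m) (Fin n) ℝ)
    (S : Fin k → Finset (Fin m))
    -- `S` is a partition of `[m]` into nonempty groups
    (hS : ∀ i, (S i).Nonempty)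
    (hdisj : ∀ i j, i ≠ j → Disjoint (S i) (S j))
    (hcover : ∀ a : Fin m, ∃ i, a ∈ S i)
    -- all rows of `A` are nonzero, and the rank `r = max_i |S_i|` is at least 2
    (hA : ∀ j, A j ≠ 0)
    (hrdef : r = Finset.univ.sup fun i => (S i).card) (hr2 : 2 ≤ r)
    (T : ℕ) (hT : 1 ≤ T) (ν : ℝ) (hν : 0 < ν)
    (w : ℕ → Fin m → ℝ) (σt : ℕ → Fin m → ℝ)
    -- `w⁽¹⁾_j = 1/|S_i|` for `j ∈ S_i`
    (hw1 : ∀ i, ∀ j ∈ S i, w 1 j = ((S i).card : ℝ)⁻¹)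
    -- positivity of the iterates
    (hwpos : ∀ t ∈ Finset.Icc 1 T, ∀ j, 0 < w t j)
    (hσpos : ∀ t ∈ Finset.Icc 1 T, ∀ j, 0 < σt t j)
    -- each `σ̃⁽ᵗ⁾` is a `ν`-bounded leverage score overestimate for `W⁽ᵗ⁾^{1/2} A`
    (hσ1 : ∀ t ∈ Finset.Icc 1 T, ∑ j, σt t j ≤ ν)
    (hσover : ∀ t ∈ Finset.Icc 1 T, ∀ j, levScore (rowScale A (w t)) j ≤ σt t j)
    -- the update rule `w⁽ᵗ⁺¹⁾_j = σ̃⁽ᵗ⁾_j / Σ_{j' ∈ S_i} σ̃⁽ᵗ⁾_{j'}`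
    (hupd : ∀ t ∈ Finset.Icc 1 T, ∀ i, ∀ j ∈ S i,
      w (t + 1) j = σt t j / ∑ j' ∈ S i, σt t j')
    -- `τ_i = exp(T⁻¹ log r) · (1/T) Σ_{t ∈ [T]} Σ_{j ∈ S_i} σ̃⁽ᵗ⁾_j` and `w̄ = (1/T) Σ_t w⁽ᵗ⁾`
    (τ : Fin k → ℝ)
    (hτdef : ∀ i, τ i = Real.exp (Real.log r / T) *
      ((1 / (T : ℝ)) * ∑ t ∈ Finset.Icc 1 T, ∑ j ∈ S i, σt t j))
    (wbar : Fin m → ℝ)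
    (hwbar : ∀ j, wbar j = (1 / (T : ℝ)) * ∑ t ∈ Finset.Icc 1 T, w t j) :
    -- conclusion: `τ` is an `exp(T⁻¹ log r)·ν`-bounded group leverage score overestimate
    -- for `G` with associated weights `w̄`
    (∀ i, 0 ≤ τ i) ∧ (∀ j, 0 ≤ wbar j) ∧
      (∑ i, τ i ≤ Real.exp (Real.log r / T) * ν) ∧
      (∀ i, ∑ j ∈ S i, wbar j = 1) ∧
      (∀ i, ∀ j ∈ S i,
        A j ⬝ᵥ ((mpinv (Aᵀ * Matrix.diagonal wbar * A)) *ᵥ A j) ≤ τ i) := by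
  have hT0 : (0 : ℝ) < T := by exact_mod_cast hT
  have hne : (Finset.Icc 1 T).Nonempty := ⟨1, by simp [hT]⟩
  have hcard : (Finset.Icc 1 T).card = T := by simp
  have hspos : ∀ t ∈ Finset.Icc 1 T, ∀ i, 0 < ∑ j ∈ S i, σt t j := fun t ht i =>
    Finset.sum_pos (fun j _ => hσpos t ht j) (hS i)
  have hτ0 : ∀ i, 0 ≤ τ i := fun i => by
    rw [hτdef]
    have := Finset.sum_nonneg fun t ht => (hspos t ht i).le
    positivity
  have hwbarpos : ∀ j, 0 < wbar j := fun j => by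
    rw [hwbar]
    have := Finset.sum_pos (fun t ht => hwpos t ht j) hne
    positivity
  refine ⟨hτ0, fun j => (hwbarpos j).le, ?_, fun i => ?_, fun i j hj => ?_⟩
  · have hgroups : ∀ f : Fin m → ℝ, ∑ i, ∑ j ∈ S i, f j = ∑ j, f j := fun f => by
      rw [← Finset.sum_biUnion fun i _ i' _ h => hdisj i i' h]
      congr 1
      ext a
      simpa using hcover a
    simp only [hτdef]
    rw [← Finset.mul_sum, ← Finset.mul_sum, Finset.sum_comm]
    simp only [hgroups]
    refine mul_le_mul_of_nonneg_left ?_ (Real.exp_pos _).le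
    have h := Finset.sum_le_card_nsmul _ _ _ hσ1
    rw [hcard, nsmul_eq_mul] at h
    rw [one_div, inv_mul_le_iff₀ hT0]
    exact h
  · have hw1sum : ∀ t ∈ Finset.Icc 1 T, ∑ j ∈ S i, w t j = 1 := by
      intro t ht
      rcases Nat.lt_or_ge 1 t with h1 | h1
      · obtain ⟨u, rfl⟩ : ∃ u, t = u + 1 := ⟨t - 1, by omega⟩
        have hu : u ∈ Finset.Icc 1 T := by
          rw [Finset.mem_Icc] at ht ⊢
          omega
        rw [Finset.sum_congr rfl (hupd u hu i), ← Finset.sum_div,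
          div_self (hspos u hu i).ne']
      · obtain rfl : t = 1 := le_antisymm h1 (Finset.mem_Icc.1 ht).1
        have : ((S i).card : ℝ) ≠ 0 := by exact_mod_cast (hS i).card_pos.ne'
        rw [Finset.sum_congr rfl (hw1 i), Finset.sum_const, nsmul_eq_mul, mul_inv_cancel₀ this]
    simp only [hwbar]
    rw [← Finset.mul_sum, Finset.sum_comm, Finset.sum_congr rfl hw1sum]
    simp [hT0.ne']
  · set q := A j ⬝ᵥ (mpinv (Aᵀ * diagonal wbar * A) *ᵥ A j)
    rcases le_or_gt q 0 with hq0 | hq0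
    · exact hq0.trans (hτ0 i)
    have hcardS : (0 : ℝ) < (S i).card := by exact_mod_cast (hS i).card_pos
    have hcardr : ((S i).card : ℝ) ≤ r := by
      rw [hrdef]
      exact_mod_cast Finset.le_sup (f := fun i => (S i).card) (Finset.mem_univ i)
    have hr0 : (0 : ℝ) < r := hcardS.trans_le hcardr
    have hharm : q * (1 / (T : ℝ) * ∑ t ∈ Finset.Icc 1 T, w t j / σt t j) ≤ 1 :=
      row_mpinv_mul_sum_div_le_one A _ (by positivity) w σt wbar hwbar hwbarpos hwpos hσpos
        hσover j hq0
    have hratio := prod_le_avg_pow _ hne (fun t => w t j / σt t j)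
      fun t ht => (div_pos (hwpos t ht j) (hσpos t ht j)).le
    have hsums := prod_le_avg_pow _ hne (fun t => ∑ j ∈ S i, σt t j)
      fun t ht => (hspos t ht i).le
    rw [hcard] at hratio hsums
    have hTmem : T ∈ Finset.Icc 1 T := by simp [hT]
    have hlast : 0 < w (T + 1) j ∧ w (T + 1) j ≤ 1 := by
      rw [hupd T hTmem i j hj]
      exact ⟨div_pos (hσpos T hTmem j) (hspos T hTmem i), div_le_one_of_le₀
        (Finset.single_le_sum (fun j _ => (hσpos T hTmem j).le) hj) (hspos T hTmem i).le⟩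
    set P := ∏ t ∈ Finset.Icc 1 T, w t j / σt t j with hP
    set Q := ∏ t ∈ Finset.Icc 1 T, ∑ j ∈ S i, σt t j with hQ
    have hP0 : 0 < P := Finset.prod_pos fun t ht => div_pos (hwpos t ht j) (hσpos t ht j)
    have hQ0 : 0 < Q := Finset.prod_pos fun t ht => hspos t ht i
    have htele : P * Q * w (T + 1) j = w 1 j := by
      have hnext : ∏ t ∈ Finset.Icc 1 T, w (t + 1) j =
          (∏ t ∈ Finset.Icc 1 T, σt t j) / Q := by
        rw [hQ, ← Finset.prod_div_distrib]
        exact Finset.prod_congr rfl fun t ht => hupd t ht i j hj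
      have h := prod_Icc_mul_succ (fun t => w t j) T
      have hσ0 : 0 < ∏ t ∈ Finset.Icc 1 T, σt t j := Finset.prod_pos fun t ht => hσpos t ht j
      rw [hnext] at h
      rw [hP, Finset.prod_div_distrib]
      field_simp at h ⊢
      linarith
    have hone : 1 ≤ r * (P * Q) := by
      have h1 : w 1 j ≤ P * Q := by
        rw [← htele]
        exact mul_le_of_le_one_right (mul_pos hP0 hQ0).le hlast.2
      rw [hw1 i j hj, inv_le_iff_one_le_mul₀ hcardS] at h1
      nlinarith [mul_pos hP0 hQ0]
    have hqP : q ^ T * P ≤ 1 := by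
      refine (mul_le_mul_of_nonneg_left hratio (pow_nonneg hq0.le T)).trans ?_
      rw [← mul_pow]
      refine pow_le_one₀ (mul_nonneg hq0.le ?_) hharm
      exact mul_nonneg (by positivity) (Finset.sum_nonneg fun t ht =>
        (div_pos (hwpos t ht j) (hσpos t ht j)).le)
    refine le_of_pow_le_pow_left₀ (show T ≠ 0 by omega) (hτ0 i) ?_
    rw [hτdef, mul_pow, ← Real.exp_nat_mul, mul_div_cancel₀ _ hT0.ne', Real.exp_log hr0]
    calc q ^ T ≤ q ^ T * (r * (P * Q)) := le_mul_of_one_le_right (pow_nonneg hq0.le T) hone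
      _ = (q ^ T * P) * (r * Q) := by ring
      _ ≤ r * Q := mul_le_of_le_one_left (by positivity) hqP
      _ ≤ _ := mul_le_mul_of_nonneg_left hsums hr0.le
end
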